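/- arXiv:2304.08917 — 2 statements merged into one kernel-verified Lean document; each statement's English description precedes it below -/
import Mathlib

section
/- The coefficient synthesis problem for threshold automata is undecidable: there is no algorithm that, given an environment Env, a sketch threshold automaton TA over Env, and a location ℓ of TA, decides whether there exists an integer assignment μ to the indeterminates such that TA[μ] cannot cover ℓ. This holds even when the input sketch is required to be acyclic. -/
namespace ThresholdAutomata

/-- A coefficient occurring in a threshold guard of a sketch: either a concrete
integer constant or an indeterminate (indeterminates are indexed by `ℕ`). -/
abbrev Coeff : Type := ℤ ⊕ ℕ

/-- The value of a coefficient under an integer assignment `μ` to the indeterminates. -/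
def Coeff.eval (μ : ℕ → ℤ) : Coeff → ℤ
  | .inl c => c
  | .inr x => μ x

/-- A threshold guard `b·x ⋈ a₀ + a₁·p₁ + … + a_|Π|·p_|Π|`, given as
`(b, x, isGe, a₀, [a₁, …])` where `x` is the index of a shared variable,
`isGe = true` means `⋈` is `≥` and `isGe = false` means `⋈` is `<`,
and each of `b, a₀, a₁, …` may be a constant or an indeterminate. -/
abbrev SGuard : Type := Coeff × ℕ × Bool × Coeff × List Coeff

/-- A rule `(from, to, φ, u)`: source location, target location, a conjunction of
threshold guards, and an update `u : Γ → {0,1}` of the shared variables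
(the `j`-th entry of the list is `true` iff shared variable `j` is incremented). -/
abbrev SRule : Type := ℕ × ℕ × List SGuard × List Bool

/-- A sketch threshold automaton `(|L|, I, |Γ|, R)`: locations are `0, …, |L| - 1`,
`I` is the list of initial locations, shared variables are `0, …, |Γ| - 1`, and
`R` is the list of rules. -/
abbrev Sketch : Type := ℕ × List ℕ × ℕ × List SRule

/-- A linear expression `c + Σᵢ aᵢ·pᵢ` over the environment variables,
given as `([a₀, …, a_{k-1}], c)`. -/
abbrev LinExpr : Type := List ℤ × ℤ

/-- The value of a linear expression at a valuation of the environment variables. -/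
def LinExpr.evalAt (e : LinExpr) (pv : ℕ → ℕ) : ℤ :=
  e.2 + ∑ i ∈ Finset.range e.1.length, e.1.getD i 0 * (pv i : ℤ)

/-- An environment `(|Π|, RC, N)`: environment variables are `0, …, |Π| - 1`,
the resilience condition `RC` is a linear formula given as a (conjunction of a)
list of linear constraints `e ≥ 0`, and the number function `N` is a linear
function of the environment variables. -/
abbrev Env : Type := ℕ × List LinExpr × LinExpr

/-- An instance of the coefficient synthesis problem: an environment `Env`,
a sketch `TA` and a location `ℓ` of `TA`. -/
abbrev Instance : Type := Env × Sketch × ℕ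

/-- Satisfaction of a threshold guard by shared-variable values `g` and
environment-variable values `pv`, under an assignment `μ` to the indeterminates. -/
def SGuard.sat (μ : ℕ → ℤ) (g : ℕ → ℕ) (pv : ℕ → ℕ) : SGuard → Prop
  | (b, x, isGe, a0, as) =>
      let lhs : ℤ := b.eval μ * (g x : ℤ)
      let rhs : ℤ := a0.eval μ +
        ∑ i ∈ Finset.range as.length, (as.getD i (.inl 0)).eval μ * (pv i : ℤ)
      if isGe then rhs ≤ lhs else lhs < rhs

/-- A configuration `σ = (κ, g, p)`: number of processes in each location,
values of the shared variables, values of the environment variables. -/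
structure Config where
  κ : ℕ → ℕ
  g : ℕ → ℕ
  p : ℕ → ℕ

/-- `C` is a configuration of the automaton with environment `env` and sketch `TA`:
the environment valuation satisfies the resilience condition, and the total number
of processes equals `N(p)`. -/
def Config.validFor (env : Env) (TA : Sketch) (C : Config) : Prop :=
  (∀ c ∈ env.2.1, 0 ≤ LinExpr.evalAt c C.p) ∧
  (∑ i ∈ Finset.range TA.1, C.κ i) = (LinExpr.evalAt env.2.2 C.p).toNat ∧
  (∀ i, TA.1 ≤ i → C.κ i = 0)

/-- An initial configuration: all processes are in initial locations and all
shared variables are `0`. -/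
def Config.initialFor (env : Env) (TA : Sketch) (C : Config) : Prop :=
  C.validFor env TA ∧ (∀ i, i ∉ TA.2.1 → C.κ i = 0) ∧ (∀ j, C.g j = 0)

/-- The step relation of `TA[μ]`: some rule whose source location is occupied and
whose guards are satisfied fires, moving one process from its source to its target
and adding its update to the shared variables. -/
def Step (TA : Sketch) (μ : ℕ → ℤ) (C C' : Config) : Prop :=
  ∃ r ∈ TA.2.2.2,
    0 < C.κ r.1 ∧ (∀ gd ∈ r.2.2.1, SGuard.sat μ C.g C.p gd) ∧
    (∀ i, C'.p i = C.p i) ∧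
    (∀ j, C'.g j = C.g j + (if r.2.2.2.getD j false then 1 else 0)) ∧
    (∀ i, C'.κ i =
      if r.1 = r.2.1 then C.κ i
      else if i = r.1 then C.κ i - 1
      else if i = r.2.1 then C.κ i + 1
      else C.κ i)

/-- `TA[μ]` can cover location `ℓ`: some initial configuration can reach a
configuration with at least one process in `ℓ`. -/
def Covers (env : Env) (TA : Sketch) (μ : ℕ → ℤ) (ℓ : ℕ) : Prop :=
  ∃ C C' : Config, C.initialFor env TA ∧
    Relation.ReflTransGen (Step TA μ) C C' ∧ 0 < C'.κ ℓ

/-- The sketch is acyclic: the directed graph on the locations with an edge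
`(r.from, r.to)` for each rule `r` has no cycles. -/
def SketchAcyclic (TA : Sketch) : Prop :=
  ∀ a : ℕ, ¬ Relation.TransGen (fun u w => ∃ r ∈ TA.2.2.2, r.1 = u ∧ r.2.1 = w) a a

section Diophantine
open Finset

lemma poly_aux {γ : Type} (p : Poly γ) : ∃ (s : Finset γ) (C d : ℕ),
    (∀ (v w : γ → ℕ) (m : ℤ), (∀ i ∈ s, (v i : ℤ) ≡ w i [ZMOD m]) → p v ≡ p w [ZMOD m]) ∧
    ∀ (v : γ → ℕ) (M : ℕ), (∀ i ∈ s, v i ≤ M) → |p v| ≤ C * ((M : ℤ) + 1) ^ d := by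
  classical
  induction p using Poly.induction with
  | H1 i =>
    refine ⟨{i}, 1, 1, fun v w m h => by simpa using h, fun v M h => ?_⟩
    have := h i (by simp)
    simp
    omega
  | H2 n =>
    refine ⟨∅, n.natAbs, 0, fun v w m h => by simp, fun v M h => by simp⟩
  | H3 f g hf hg =>
    obtain ⟨s, C, d, h1, h2⟩ := hf
    obtain ⟨s', C', d', h1', h2'⟩ := hg
    refine ⟨s ∪ s', C + C', d + d', fun v w m h => ?_, fun v M h => ?_⟩
    · exact (h1 v w m fun i hi => h i (by simp [hi])).sub (h1' v w m fun i hi => h i (by simp [hi]))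
    · have a := h2 v M fun i hi => h i (by simp [hi])
      have b := h2' v M fun i hi => h i (by simp [hi])
      have e1 : ((M : ℤ) + 1) ^ d ≤ (M + 1) ^ (d + d') :=
        pow_le_pow_right₀ (by omega) (by omega)
      have e2 : ((M : ℤ) + 1) ^ d' ≤ (M + 1) ^ (d + d') :=
        pow_le_pow_right₀ (by omega) (by omega)
      calc |f v - g v| ≤ |f v| + |g v| := abs_sub _ _
        _ ≤ C * ((M : ℤ) + 1) ^ d + C' * ((M : ℤ) + 1) ^ d' := by omega
        _ ≤ C * ((M : ℤ) + 1) ^ (d + d') + C' * ((M : ℤ) + 1) ^ (d + d') := by gcongr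
        _ = _ := by push_cast; ring
  | H4 f g hf hg =>
    obtain ⟨s, C, d, h1, h2⟩ := hf
    obtain ⟨s', C', d', h1', h2'⟩ := hg
    refine ⟨s ∪ s', C * C', d + d', fun v w m h => ?_, fun v M h => ?_⟩
    · exact (h1 v w m fun i hi => h i (by simp [hi])).mul (h1' v w m fun i hi => h i (by simp [hi]))
    · have a := h2 v M fun i hi => h i (by simp [hi])
      have b := h2' v M fun i hi => h i (by simp [hi])
      calc |f v * g v| = |f v| * |g v| := abs_mul _ _
        _ ≤ (C * ((M : ℤ) + 1) ^ d) * (C' * ((M : ℤ) + 1) ^ d') := by gcongr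
        _ = _ := by push_cast; ring

/-- the moduli -/
def mm (Q k : ℕ) : ℕ := Q.factorial ^ 2 / (k + 1) - 1

lemma mm_mul {Q k : ℕ} (h : k < Q) : (k + 1) * mm Q k = Q.factorial ^ 2 - (k + 1) := by
  have : k + 1 ∣ Q.factorial := Nat.dvd_factorial (by omega) (by omega)
  have h2 : k + 1 ∣ Q.factorial ^ 2 := this.trans (dvd_pow_self _ (by omega))
  rw [mm, Nat.mul_sub, Nat.mul_div_cancel' h2, mul_one]

lemma mm_succ {Q k : ℕ} (h : k < Q) : mm Q k + 1 = Q.factorial * (Q.factorial / (k + 1)) := by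
  have : k + 1 ∣ Q.factorial := Nat.dvd_factorial (by omega) (by omega)
  have h3 : 0 < Q.factorial * (Q.factorial / (k + 1)) :=
    Nat.mul_pos (Nat.factorial_pos _) (Nat.div_pos (Nat.le_of_dvd (Nat.factorial_pos _) this) (by omega))
  rw [mm, pow_two, Nat.mul_div_assoc _ this]
  omega

lemma mm_prime {Q k q : ℕ} (h : k < Q) (hq : q.Prime) (hd : q ∣ mm Q k) : Q < q := by
  by_contra hc
  have h1 : q ∣ Q.factorial := Nat.dvd_factorial hq.pos (by omega)
  have h2 : q ∣ mm Q k + 1 := by rw [mm_succ h]; exact h1.mul_right _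
  exact hq.one_lt.ne' (Nat.dvd_one.1 ((Nat.dvd_add_right hd).1 h2))

lemma mm_two {Q k : ℕ} (h : k < Q) (hQ : 3 ≤ Q) : 2 ≤ mm Q k := by
  have h0 := mm_succ h
  have : k + 1 ∣ Q.factorial := Nat.dvd_factorial (by omega) (by omega)
  have h3 : 1 ≤ (Q.factorial / (k + 1)) :=
    (Nat.div_pos (Nat.le_of_dvd (Nat.factorial_pos _) this) (by omega))
  have := Nat.self_le_factorial Q
  nlinarith

lemma le_fac {Q k : ℕ} (h : k < Q) : k + 1 ≤ Q.factorial ^ 2 := by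
  have := Nat.self_le_factorial Q
  nlinarith

lemma mm_modEq {Q k : ℕ} (h : k < Q) : k ≡ Q.factorial ^ 2 - 1 [MOD mm Q k] := by
  have h1 := mm_mul h
  have h2 := le_fac h
  rw [Nat.modEq_iff_dvd' (by omega)]
  exact ⟨k + 1, by rw [mul_comm, h1]; omega⟩

lemma mm_coprime {Q j k : ℕ} (hj : j < Q) (hk : k < Q) (hjk : j ≠ k) :
    Nat.Coprime (mm Q j) (mm Q k) := by
  refine Nat.Coprime.symm (Nat.coprime_of_dvd fun q hq h1 h2 => ?_)
  have hQ := mm_prime hj hq h2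
  have e1 : j ≡ k [MOD q] := ((mm_modEq hj).of_dvd h2).trans ((mm_modEq hk).of_dvd h1).symm
  exact hjk (Nat.ModEq.eq_of_lt_of_lt e1 (by omega) (by omega))

lemma mm_prod {Q y : ℕ} (h : y ≤ Q) :
    ∏ k ∈ range y, mm Q k = (Q.factorial ^ 2 - 1).choose y := by
  have h1 : y.factorial * ∏ k ∈ range y, mm Q k = y.factorial * (Q.factorial ^ 2 - 1).choose y := by
    rw [← Nat.descFactorial_eq_factorial_mul_choose, Nat.descFactorial_eq_prod_range,
      ← Finset.prod_range_add_one_eq_factorial, ← Finset.prod_mul_distrib]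
    refine Finset.prod_congr rfl fun k hk => ?_
    simp at hk
    rw [mm_mul (by omega)]; omega
  exact Nat.eq_of_mul_eq_mul_left (Nat.factorial_pos _) h1

/-- core equivalence for the bounded quantifier theorem -/
lemma core {α β : Type} (p : Poly (Option α ⊕ β)) : ∃ (s : Finset (Option α ⊕ β)) (C d : ℕ),
    ∀ (v : α → ℕ) (y : ℕ), (∀ k < y, ∃ t : β → ℕ, p (Sum.elim (Option.elim' k v) t) = 0) ↔
      ∃ a : β → ℕ, ∃ M : ℕ, (∀ i ∈ s, Sum.elim (Option.elim' 0 v) (fun _ => 0) i ≤ M) ∧ y ≤ M ∧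
        (∀ i ∈ s, Sum.elim (fun _ => 0)
          (fun b => (a b).choose (M + 1)) i % ((C * (M + 1) ^ d + M + 3).factorial ^ 2 - 1).choose y = 0) ∧
        (p (Sum.elim (Option.elim' ((C * (M + 1) ^ d + M + 3).factorial ^ 2 - 1) v) a)).natAbs %
          ((C * (M + 1) ^ d + M + 3).factorial ^ 2 - 1).choose y = 0 := by
  classical
  obtain ⟨s, C, d, h1, h2⟩ := poly_aux p
  refine ⟨s, C, d, fun v y => ⟨fun H => ?_, ?_⟩⟩
  · choose! t ht using H
    obtain ⟨M, hM⟩ : ∃ M : ℕ, y ≤ M ∧ ∀ i ∈ s, Sum.elim (Option.elim' 0 v) (fun _ => 0) i ≤ M ∧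
        ∀ k < y, Sum.elim (fun _ => 0) (t k) i ≤ M := by
      refine ⟨y + ∑ i ∈ s, Sum.elim (Option.elim' 0 v) (fun _ => 0) i +
        ∑ i ∈ s, ∑ k ∈ range y, Sum.elim (fun _ => 0) (t k) i, by omega, fun i hi => ⟨?_, fun k hk => ?_⟩⟩
      · have := Finset.single_le_sum (f := fun i => Sum.elim (Option.elim' 0 v) (fun _ => 0) i) (fun _ _ => Nat.zero_le _) hi
        omega
      · have a1 := Finset.single_le_sum (f := fun i => ∑ k ∈ range y, Sum.elim (fun _ => 0) (t k) i) (fun _ _ => Nat.zero_le _) hi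
        have a2 := Finset.single_le_sum (f := fun k => Sum.elim (fun _ => 0) (t k) i) (fun _ _ => Nat.zero_le _) (Finset.mem_range.2 hk)
        omega
    obtain ⟨hy, hM⟩ := hM
    set Q := C * (M + 1) ^ d + M + 3 with hQ
    have hyQ : y ≤ Q := by omega
    have crt : ∀ b : β, ∃ x, ∀ k < y, x ≡ t k b [MOD mm Q k] := by
      intro b
      have := Nat.chineseRemainderOfFinset (fun k => t k b) (mm Q) (range y)
        (fun i hi => by
          have := mm_two (Q := Q) (k := i) (by simp at hi; omega) (by omega)
          omega)
        (fun i hi j hj hij => by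
          simp at hi hj
          exact mm_coprime (by omega) (by omega) hij)
      exact ⟨this.1, fun k hk => this.2 k (by simpa using hk)⟩
    choose a ha using crt
    refine ⟨a, M, fun i hi => (hM i hi).1, hy, ?_, ?_⟩
    · rintro (i | b) hi
      · simp
      rw [← mm_prod hyQ]
      simp only [Sum.elim_inr]
      apply Nat.mod_eq_zero_of_dvd
      have cop : Nat.Coprime (∏ k ∈ range y, mm Q k) (M + 1).factorial := by
        refine Nat.Coprime.prod_left fun k hk => ?_
        simp at hk
        refine Nat.Coprime.symm (Nat.coprime_of_dvd fun q hq h1 h2 => ?_)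
        have := mm_prime (by omega) hq h2
        have := (hq.dvd_factorial).1 h1
        omega
      refine cop.dvd_of_dvd_mul_left ?_
      rw [← Nat.descFactorial_eq_factorial_mul_choose, Nat.descFactorial_eq_prod_range]
      refine Finset.prod_dvd_of_isRelPrime (fun i hi j hj hij => ?_) (fun k hk => ?_)
      · simp at hi hj
        exact Nat.coprime_iff_isRelPrime.1 (mm_coprime (Q := Q) (by omega) (by omega) hij)
      · simp at hk
        have hk2 := (hM _ hi).2 k hk
        simp only [Sum.elim_inr] at hk2
        refine Dvd.dvd.trans ?_ (Finset.dvd_prod_of_mem _ (Finset.mem_range.2 (Nat.lt_succ_of_le hk2)))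
        rcases le_total (t k b) (a b) with h | h
        · exact (Nat.modEq_iff_dvd' h).1 (ha b k hk).symm
        · simp [Nat.sub_eq_zero_of_le h]
    · rw [← mm_prod hyQ]
      apply Nat.mod_eq_zero_of_dvd
      refine Finset.prod_dvd_of_isRelPrime (fun i hi j hj hij => ?_) (fun k hk => ?_)
      · simp at hi hj
        exact Nat.coprime_iff_isRelPrime.1 (mm_coprime (Q := Q) (by omega) (by omega) hij)
      · simp at hk
        rw [← Int.natCast_dvd]
        apply Int.dvd_of_emod_eq_zero
        rw [← Int.zero_emod (mm Q k), ← ht k hk]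
        refine h1 _ _ _ ?_
        rintro ((_ | j) | b) hi
        · exact (Int.natCast_modEq_iff.2 (mm_modEq (by omega))).symm
        · rfl
        · exact Int.natCast_modEq_iff.2 (ha b k hk)
  · rintro ⟨a, M, hv, hy, hb, hp⟩ k hk
    set Q := C * (M + 1) ^ d + M + 3 with hQ
    have hyQ : y ≤ Q := by omega
    rw [← mm_prod hyQ] at hp hb
    obtain ⟨q, hq, hqd⟩ := Nat.exists_prime_and_dvd (n := mm Q k) (by
      have := mm_two (Q := Q) (k := k) (by omega) (by omega)
      omega)
    have hqQ := mm_prime (by omega) hq hqd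
    have hqN : q ∣ ∏ k ∈ range y, mm Q k := hqd.trans (Finset.dvd_prod_of_mem _ (by simpa using hk))
    refine ⟨fun b => a b % q, ?_⟩
    have hle : ∀ b, Sum.inr b ∈ s → a b % q ≤ M := by
      intro b hbs
      have h3 := hb _ hbs
      simp only [Sum.elim_inr] at h3
      have h4 : q ∣ (a b).descFactorial (M + 1) := by
        rw [Nat.descFactorial_eq_factorial_mul_choose]
        exact (hqN.trans (Nat.dvd_of_mod_eq_zero h3)).mul_left _
      rw [Nat.descFactorial_eq_prod_range, Prime.dvd_finsetProd_iff hq.prime] at h4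
      obtain ⟨j, hj, h5⟩ := h4
      simp at hj
      rcases le_total j (a b) with h | h
      · have := (Nat.modEq_iff_dvd' h).2 h5
        have h6 : j % q = a b % q := this
        rw [← h6, Nat.mod_eq_of_lt (by omega)]; omega
      · exact (Nat.mod_le _ _).trans (by omega)
    have hmod : p (Sum.elim (Option.elim' k v) (fun b => a b % q)) ≡
        p (Sum.elim (Option.elim' (Q.factorial ^ 2 - 1) v) a) [ZMOD q] := by
      refine h1 _ _ _ ?_
      rintro ((_ | j) | b) hi
      · exact (Int.natCast_modEq_iff.2 ((mm_modEq (by omega)).of_dvd hqd))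
      · rfl
      · exact Int.natCast_modEq_iff.2 (Nat.mod_modEq _ _)
    have hz : (q : ℤ) ∣ p (Sum.elim (Option.elim' k v) (fun b => a b % q)) := by
      rw [hmod.dvd_iff, Int.natCast_dvd]
      exact hqN.trans (Nat.dvd_of_mod_eq_zero hp)
    have hbd := h2 (Sum.elim (Option.elim' k v) (fun b => a b % q)) M (by
      rintro ((_ | j) | b) hi
      · simp; omega
      · exact hv _ hi
      · exact hle b hi)
    refine Int.eq_zero_of_abs_lt_dvd hz (lt_of_le_of_lt hbd ?_)
    have : C * (M + 1) ^ d < q := by omega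
    exact_mod_cast this


lemma digit_sum (u : ℕ) (k : ℕ) : ∀ (f : ℕ → ℕ) (m : ℕ), (∀ i, f i < u) → k < m →
    (∑ i ∈ range m, f i * u ^ i) / u ^ k % u = f k := by
  induction k with
  | zero =>
    intro f m hf hm
    obtain ⟨m, rfl⟩ : ∃ m', m = m' + 1 := ⟨m - 1, by omega⟩
    rw [Finset.sum_range_succ']
    have : ∀ i ∈ range m, f (i + 1) * u ^ (i + 1) = u * (f (i + 1) * u ^ i) := fun i _ => by ring
    rw [Finset.sum_congr rfl this, ← Finset.mul_sum]
    simp [Nat.mod_eq_of_lt (hf 0)]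
  | succ k ih =>
    intro f m hf hm
    obtain ⟨m, rfl⟩ : ∃ m', m = m' + 1 := ⟨m - 1, by omega⟩
    have hu : 0 < u := lt_of_le_of_lt (Nat.zero_le _) (hf 0)
    rw [Finset.sum_range_succ']
    have : ∀ i ∈ range m, f (i + 1) * u ^ (i + 1) = u * (f (i + 1) * u ^ i) := fun i _ => by ring
    rw [Finset.sum_congr rfl this, ← Finset.mul_sum, pow_succ', ← Nat.div_div_eq_div_mul,
      Nat.mul_add_div hu, pow_zero, mul_one, Nat.div_eq_of_lt (hf 0), add_zero]
    exact ih (fun i => f (i + 1)) m (fun i => hf _) (by omega)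

lemma choose_eq (n k : ℕ) : n.choose k = (2 ^ n + 1 + 1) ^ n / (2 ^ n + 1) ^ k % (2 ^ n + 1) := by
  have := digit_sum (2 ^ n + 1) k (fun i => n.choose i) (n + 1 + k)
    (fun i => Nat.lt_succ_of_le (Nat.choose_le_two_pow _ _)) (by omega)
  rw [← this, Finset.sum_range_add]
  simp only [Nat.choose_eq_zero_of_lt (show ∀ {i}, n < n + 1 + i by omega), zero_mul,
    Finset.sum_const_zero, add_zero]
  rw [add_pow (2 ^ n + 1) 1 n]
  simp only [one_pow, mul_comm, one_mul, Nat.cast_id]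

lemma fac_eq (n r : ℕ) (hr : (n.factorial + 1) * n ^ 2 + n < r) :
    n.factorial = r ^ n / r.choose n := by
  have hn : n ≤ r := by omega
  have hC : 0 < r.choose n := Nat.choose_pos hn
  have hd := Nat.descFactorial_eq_factorial_mul_choose r n
  have h1 : r.descFactorial n ≤ r ^ n := Nat.descFactorial_le_pow _ _
  have h2 : (r - n) ^ n ≤ r.descFactorial n :=
    le_trans (Nat.pow_le_pow_left (by omega) _) (Nat.pow_sub_le_descFactorial r n)
  have bern : ∀ m : ℕ, (r : ℤ) ^ m * (r - m * n) ≤ r * (r - n : ℤ) ^ m := by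
    intro m
    induction m with
    | zero => simp
    | succ m ih =>
      have h0 : (0 : ℤ) ≤ r - n := by omega
      have h3 := mul_le_mul_of_nonneg_right ih h0
      have h4 : (0 : ℤ) ≤ (r : ℤ) ^ m * (m * n ^ 2) := by positivity
      push_cast
      rw [pow_succ, pow_succ]
      nlinarith
  have b := bern n
  have h2' : ((r : ℤ) - n) ^ n ≤ r.descFactorial n := by
    rw [← Nat.cast_sub hn]; exact_mod_cast h2
  have hr0 : (0 : ℤ) < r := by omega
  have h5 : (r : ℤ) ^ n * (r - n * n) ≤ r * r.descFactorial n :=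
    b.trans (mul_le_mul_of_nonneg_left h2' hr0.le)
  symm
  apply Nat.div_eq_of_lt_le
  · rw [← hd]; exact h1
  · have hd' : (r.descFactorial n : ℤ) = n.factorial * r.choose n := by exact_mod_cast hd
    have hf : (0 : ℤ) < n.factorial := by exact_mod_cast Nat.factorial_pos n
    zify at hr ⊢
    have hp : (0 : ℤ) < (r : ℤ) ^ n := by positivity
    have key : (n.factorial * r : ℤ) * r ^ n < (n.factorial * r : ℤ) * ((n.factorial + 1) * r.choose n) := by
      have e1 : (n.factorial : ℤ) * r < (n.factorial + 1) * (r - n * n) := by nlinarith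
      calc (n.factorial * r : ℤ) * r ^ n < ((n.factorial + 1) * (r - n * n)) * r ^ n :=
            mul_lt_mul_of_pos_right e1 hp
        _ = (n.factorial + 1) * (r ^ n * (r - n * n)) := by ring
        _ ≤ (n.factorial + 1) * (r * r.descFactorial n) :=
            mul_le_mul_of_nonneg_left h5 (by omega)
        _ = _ := by rw [hd']; ring
    exact lt_of_mul_lt_mul_left key (by positivity)

lemma fac_eq' (n : ℕ) : n.factorial =
    ((n ^ n + 1) * n ^ 2 + n + 1) ^ n / ((n ^ n + 1) * n ^ 2 + n + 1).choose n := by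
  apply fac_eq
  have := Nat.factorial_le_pow n
  have h2 : (n.factorial + 1) * n ^ 2 ≤ (n ^ n + 1) * n ^ 2 := Nat.mul_le_mul_right _ (by omega)
  omega

section
open Dioph
open scoped Dioph

variable {α : Type}

lemma choose_dioph {f g : (α → ℕ) → ℕ} (df : DiophFn f) (dg : DiophFn g) :
    DiophFn fun v => (f v).choose (g v) := by
  simp only [choose_eq]
  have h2 : DiophFn fun v => 2 ^ f v := pow_dioph (D.2) df
  exact mod_dioph (div_dioph (pow_dioph (h2 D+ D.1 D+ D.1) df) (pow_dioph (h2 D+ D.1) dg))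
    (h2 D+ D.1)

lemma fac_dioph {f : (α → ℕ) → ℕ} (df : DiophFn f) : DiophFn fun v => (f v).factorial := by
  rw [show (fun v => (f v).factorial) = _ from funext fun v => fac_eq' (f v)]
  have h2 : DiophFn fun v => ((f v ^ f v + 1) * f v ^ 2 + f v + 1) :=
    ((pow_dioph df df) D+ D.1) D* (pow_dioph df (D.2)) D+ df D+ D.1
  exact div_dioph (pow_dioph h2 df) (choose_dioph h2 df)

lemma forall_mem_dioph {ι : Type} (s : Finset ι) (S : ι → Set (α → ℕ)) (h : ∀ i, Dioph (S i)) :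
    Dioph {v | ∀ i ∈ s, v ∈ S i} := by
  classical
  induction s using Finset.induction_on with
  | empty => exact (D.0 D= D.0 : Dioph {v : α → ℕ | _}).ext (by simp)
  | insert a s ha ih => exact ((h a).inter ih).ext (by intro v; simp)

lemma diophFn_subst {F : (Option α → ℕ) → ℕ} (dF : DiophFn F) {g : (α → ℕ) → ℕ} (dg : DiophFn g) :
    DiophFn fun w => F (Option.elim' (g w) w) := by
  have h1 := reindex_dioph (Option (Option α))
    (Option.elim' (some none) (Option.elim' none (fun i => some (some i)))) dF
  have h2 := diophFn_comp1 h1 (reindex_diophFn some dg)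
  refine h2.ext fun v => ?_
  simp only [Set.mem_ofPred_eq]
  apply iff_of_eq
  congr 2
  ext (_ | i) <;> rfl

lemma ball_dioph {S : Set (Option α → ℕ)} (d : Dioph S) {f : (α → ℕ) → ℕ} (df : DiophFn f) :
    Dioph {v : α → ℕ | ∀ k < f v, Option.elim' k v ∈ S} := by
  obtain ⟨β, p, hp⟩ := d
  obtain ⟨s, C, d, h⟩ := core p
  simp only [hp, h]
  refine ex_dioph (S := {w : α ⊕ β → ℕ | ∃ M, (∀ i ∈ s, Sum.elim (Option.elim' 0 (w ∘ Sum.inl)) (fun _ => 0) i ≤ M) ∧ f (w ∘ Sum.inl) ≤ M ∧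
        (∀ i ∈ s, Sum.elim (fun _ => 0)
          (fun b => (w (Sum.inr b)).choose (M + 1)) i % ((C * (M + 1) ^ d + M + 3).factorial ^ 2 - 1).choose (f (w ∘ Sum.inl)) = 0) ∧
        (p (Sum.elim (Option.elim' ((C * (M + 1) ^ d + M + 3).factorial ^ 2 - 1) (w ∘ Sum.inl)) (w ∘ Sum.inr))).natAbs %
          ((C * (M + 1) ^ d + M + 3).factorial ^ 2 - 1).choose (f (w ∘ Sum.inl)) = 0}) ?_
  refine ex1_dioph (S := {w : Option (α ⊕ β) → ℕ | (∀ i ∈ s, Sum.elim (Option.elim' 0 (w ∘ some ∘ Sum.inl)) (fun _ => 0) i ≤ w none) ∧ f (w ∘ some ∘ Sum.inl) ≤ w none ∧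
        (∀ i ∈ s, Sum.elim (fun _ => 0)
          (fun b => (w (some (Sum.inr b))).choose (w none + 1)) i % ((C * (w none + 1) ^ d + w none + 3).factorial ^ 2 - 1).choose (f (w ∘ some ∘ Sum.inl)) = 0) ∧
        (p (Sum.elim (Option.elim' ((C * (w none + 1) ^ d + w none + 3).factorial ^ 2 - 1) (w ∘ some ∘ Sum.inl)) (w ∘ some ∘ Sum.inr))).natAbs %
          ((C * (w none + 1) ^ d + w none + 3).factorial ^ 2 - 1).choose (f (w ∘ some ∘ Sum.inl)) = 0}) ?_
  have hM : DiophFn fun w : Option (α ⊕ β) → ℕ => w none := proj_dioph _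
  have hf : DiophFn fun w : Option (α ⊕ β) → ℕ => f (w ∘ some ∘ Sum.inl) := reindex_diophFn _ df
  have hT : DiophFn fun w : Option (α ⊕ β) → ℕ => ((C * (w none + 1) ^ d + w none + 3).factorial ^ 2 - 1) :=
    sub_dioph (pow_dioph (fac_dioph (const_dioph C D* (pow_dioph (hM D+ D.1) (const_dioph d)) D+ hM D+ D.3)) (D.2)) (D.1)
  have hN := choose_dioph hT hf
  refine Dioph.inter ?_ (Dioph.inter ?_ (Dioph.inter ?_ ?_))
  · refine forall_mem_dioph s (fun i => {w : Option (α ⊕ β) → ℕ | Sum.elim (Option.elim' 0 (w ∘ some ∘ Sum.inl)) (fun _ => 0) i ≤ w none}) ?_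
    rintro ((_ | i) | b)
    · exact D.0 D≤ hM
    · exact proj_dioph (some (Sum.inl i)) D≤ hM
    · exact D.0 D≤ hM
  · exact hf D≤ hM
  · refine forall_mem_dioph s (fun i => {w : Option (α ⊕ β) → ℕ | Sum.elim (fun _ => 0)
          (fun b => (w (some (Sum.inr b))).choose (w none + 1)) i % ((C * (w none + 1) ^ d + w none + 3).factorial ^ 2 - 1).choose (f (w ∘ some ∘ Sum.inl)) = 0}) ?_
    rintro (i | b)
    · exact D.0 D% hN D= D.0
    · exact (choose_dioph (proj_dioph (some (Sum.inr b))) (hM D+ D.1)) D% hN D= D.0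
  · refine mod_dioph ?_ hN D= D.0
    have h1 := diophFn_subst (abs_poly_dioph (p.map (Sum.elim (Option.elim' none
      (fun i => some (some (Sum.inl i)))) (fun b => some (some (Sum.inr b)))))) hT
    convert! h1 using 4 with w
    simp only [Poly.map_apply]
    congr 1
    ext ((_ | i) | b) <;> rfl

open Vector3 Fin2
open scoped Vector3

lemma vec_ball_dioph {n : ℕ} {S : Set (Vector3 ℕ (n + 1))} (d : Dioph S) {f : Vector3 ℕ n → ℕ}
    (df : DiophFn f) : Dioph {v : Vector3 ℕ n | ∀ k < f v, (Vector3.cons k v) ∈ S} :=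
  Dioph.ext (ball_dioph (reindex_dioph _ (Vector3.cons none some) d) df) fun v => by
    refine forall_congr' fun k => forall_congr' fun _ => ?_
    simp only [Set.mem_ofPred_eq]
    apply iff_of_eq
    congr 1
    ext x; cases x <;> rfl

lemma pair_dioph {f g : (α → ℕ) → ℕ} (df : DiophFn f) (dg : DiophFn g) :
    DiophFn fun v => Nat.pair (f v) (g v) := by
  refine diophFn_comp2 (h := Nat.pair) df dg <| (diophFn_vec _).2 <| Dioph.ext
    ((D&1 D< D&2 D∧ D&2 D* D&2 D+ D&1 D= D&0) D∨
      (D&2 D≤ D&1 D∧ D&1 D* D&1 D+ D&1 D+ D&2 D= D&0)) ?_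
  refine (vectorAll_iff_forall _).1 fun z x y => ?_
  show (x < y ∧ y * y + x = z) ∨ (y ≤ x ∧ x * x + x + y = z) ↔ Nat.pair x y = z
  unfold Nat.pair
  split_ifs <;> omega

lemma unpair1_dioph {f : (α → ℕ) → ℕ} (df : DiophFn f) : DiophFn fun v => (f v).unpair.1 := by
  refine diophFn_comp (f := fun v : Vector3 ℕ 1 => (v &0).unpair.1) ?_ [f] df
  refine (diophFn_vec _).2 <| Dioph.ext ((D∃) 2 <| pair_dioph (D&1) (D&0) D= D&2) ?_
  refine (vectorAll_iff_forall _).1 fun z x => ?_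
  show (∃ y, Nat.pair z y = x) ↔ x.unpair.1 = z
  constructor
  · rintro ⟨y, rfl⟩; simp
  · rintro rfl; exact ⟨x.unpair.2, by simp⟩

lemma unpair2_dioph {f : (α → ℕ) → ℕ} (df : DiophFn f) : DiophFn fun v => (f v).unpair.2 := by
  refine diophFn_comp (f := fun v : Vector3 ℕ 1 => (v &0).unpair.2) ?_ [f] df
  refine (diophFn_vec _).2 <| Dioph.ext ((D∃) 2 <| pair_dioph (D&0) (D&1) D= D&2) ?_
  refine (vectorAll_iff_forall _).1 fun z x => ?_
  show (∃ y, Nat.pair y z = x) ↔ x.unpair.2 = z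
  constructor
  · rintro ⟨y, rfl⟩; simp
  · rintro rfl; exact ⟨x.unpair.1, by simp⟩

lemma beta_dioph {f g : (α → ℕ) → ℕ} (df : DiophFn f) (dg : DiophFn g) :
    DiophFn fun v => Nat.beta (f v) (g v) :=
  unpair1_dioph df D% ((dg D+ D.1) D* unpair2_dioph df D+ D.1)

lemma seq_exists (N : ℕ) (h : ℕ → ℕ) : ∃ s, ∀ k ≤ N, Nat.beta s k = h k := by
  refine ⟨Nat.unbeta ((List.range (N + 1)).map h), fun k hk => ?_⟩
  have := Nat.beta_unbeta_coe ((List.range (N + 1)).map h) ⟨k, by simp; omega⟩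
  simpa using this

lemma prec_iff (f g : ℕ →. ℕ) (a N z : ℕ) :
    z ∈ (N.rec (f a) fun y IH => do let i ← IH; g (Nat.pair a (Nat.pair y i)) : Part ℕ) ↔
    ∃ s, Nat.beta s 0 ∈ f a ∧ Nat.beta s N = z ∧
      ∀ k < N, Nat.beta s (k + 1) ∈ g (Nat.pair a (Nat.pair k (Nat.beta s k))) := by
  constructor
  · intro hz
    obtain ⟨h, h0, h1, h2⟩ : ∃ h : ℕ → ℕ, h 0 ∈ f a ∧ h N = z ∧
        ∀ k < N, h (k + 1) ∈ g (Nat.pair a (Nat.pair k (h k))) := by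
      induction N generalizing z with
      | zero => exact ⟨fun _ => z, hz, rfl, by simp⟩
      | succ N ih =>
        simp only [Part.bind_eq_bind, Part.mem_bind_iff] at hz
        obtain ⟨i, hi, hg⟩ := hz
        obtain ⟨h, h0, h1, h2⟩ := ih i hi
        refine ⟨fun k => if k ≤ N then h k else z, by simpa using h0, by simp, fun k hk => ?_⟩
        rcases Nat.lt_or_ge k N with h3 | h3
        · simpa [show k ≤ N by omega, show k + 1 ≤ N by omega] using h2 k h3
        · obtain rfl : k = N := by omega
          simpa [h1] using hg
    obtain ⟨s, hs⟩ := seq_exists N h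
    refine ⟨s, by rwa [hs 0 (by omega)], by rw [hs N le_rfl, h1], fun k hk => ?_⟩
    rw [hs _ hk, hs k (by omega)]
    exact h2 k hk
  · rintro ⟨s, h0, rfl, h2⟩
    induction N with
    | zero => exact h0
    | succ N ih =>
      simp only [Part.bind_eq_bind, Part.mem_bind_iff]
      exact ⟨_, ih fun k hk => h2 k (by omega), h2 N (by omega)⟩

lemma rfind_iff (f : ℕ → Part ℕ) (x z : ℕ) :
    z ∈ Nat.rfind (fun n => (fun m => decide (m = 0)) <$> f (Nat.pair x n)) ↔
    (0 ∈ f (Nat.pair x z) ∧ ∀ k < z, ∃ y, y ∈ f (Nat.pair x k) ∧ y ≠ 0) := by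
  refine Nat.mem_rfind.trans ?_
  change (true ∈ Part.map (fun m => decide (m = 0)) (f (Nat.pair x z)) ∧
    ∀ {k : ℕ}, k < z → false ∈ Part.map (fun m => decide (m = 0)) (f (Nat.pair x k))) ↔ _
  simp [Part.mem_map_iff]

/-- **DPRM**: the graph of a partial recursive function is Diophantine. -/
theorem partrec_dioph {F : ℕ →. ℕ} (hF : Nat.Partrec F) :
    Dioph {v : Vector3 ℕ 2 | v &1 ∈ F (v &0)} := by
  induction hF with
  | zero =>
    exact (D&1 D= D.0).ext fun v => by
      show v &1 = 0 ↔ v &1 ∈ Part.some 0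
      simp
  | succ =>
    exact (D&1 D= D&0 D+ D.1).ext fun v => by
      show v &1 = v &0 + 1 ↔ v &1 ∈ Part.some (v &0 + 1)
      simp
  | left =>
    exact (D&1 D= unpair1_dioph (D&0)).ext fun v => by
      show v &1 = (v &0).unpair.1 ↔ v &1 ∈ Part.some (v &0).unpair.1
      simp
  | right =>
    exact (D&1 D= unpair2_dioph (D&0)).ext fun v => by
      show v &1 = (v &0).unpair.2 ↔ v &1 ∈ Part.some (v &0).unpair.2
      simp
  | @pair f g _ _ hf hg =>
    have h1 : Dioph {v : Vector3 ℕ 4 | v &0 ∈ f (v &2)} :=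
      dioph_comp2 (S := fun a b => b ∈ f a) (D&2) (D&0) hf
    have h2 : Dioph {v : Vector3 ℕ 4 | v &1 ∈ g (v &2)} :=
      dioph_comp2 (S := fun a b => b ∈ g a) (D&2) (D&1) hg
    refine ((D∃) 2 <| (D∃) 3 <| h1 D∧ h2 D∧ D&3 D= pair_dioph (D&0) (D&1)).ext ?_
    refine (vectorAll_iff_forall _).1 fun x z => ?_
    show (∃ b a, a ∈ f x ∧ b ∈ g x ∧ z = Nat.pair a b) ↔ z ∈ (Nat.pair <$> f x <*> g x : Part ℕ)
    simp only [Seq.seq, Part.map_eq_map, Part.mem_bind_iff, Part.mem_map_iff]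
    constructor
    · rintro ⟨b, a, ha, hb, rfl⟩
      exact ⟨_, ⟨a, ha, rfl⟩, b, hb, rfl⟩
    · rintro ⟨_, ⟨a, ha, rfl⟩, b, hb, rfl⟩
      exact ⟨b, a, ha, hb, rfl⟩
  | @comp f g _ _ hf hg =>
    have h1 : Dioph {v : Vector3 ℕ 3 | v &0 ∈ g (v &1)} :=
      dioph_comp2 (S := fun a b => b ∈ g a) (D&1) (D&0) hg
    have h2 : Dioph {v : Vector3 ℕ 3 | v &2 ∈ f (v &0)} :=
      dioph_comp2 (S := fun a b => b ∈ f a) (D&0) (D&2) hf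
    refine ((D∃) 2 <| h1 D∧ h2).ext ?_
    refine (vectorAll_iff_forall _).1 fun x z => ?_
    exact (Part.mem_bind_iff (f := g x) (g := f) (b := z)).symm
  | @prec f g _ _ hf hg =>
    have h1 : Dioph {v : Vector3 ℕ 3 | Nat.beta (v &0) 0 ∈ f (v &1).unpair.1} :=
      dioph_comp2 (S := fun a b => b ∈ f a) (unpair1_dioph (D&1)) (beta_dioph (D&0) (D.0)) hf
    have h2 : Dioph {v : Vector3 ℕ 4 | Nat.beta (v &1) (v &0 + 1) ∈
        g (Nat.pair (v &2).unpair.1 (Nat.pair (v &0) (Nat.beta (v &1) (v &0))))} :=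
      dioph_comp2 (S := fun a b => b ∈ g a)
        (pair_dioph (unpair1_dioph (D&2)) (pair_dioph (D&0) (beta_dioph (D&1) (D&0))))
        (beta_dioph (D&1) (D&0 D+ D.1)) hg
    refine ((D∃) 2 <| h1 D∧ (beta_dioph (D&0) (unpair2_dioph (D&1)) D= D&2) D∧
      vec_ball_dioph h2 (unpair2_dioph (D&1))).ext ?_
    refine (vectorAll_iff_forall _).1 fun x z => ?_
    exact (prec_iff f g x.unpair.1 x.unpair.2 z).symm
  | @rfind f _ hf =>
    have h1 : Dioph {v : Vector3 ℕ 2 | 0 ∈ f (Nat.pair (v &0) (v &1))} :=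
      dioph_comp2 (S := fun a b => b ∈ f a) (pair_dioph (D&0) (D&1)) (D.0) hf
    have h2 : Dioph {v : Vector3 ℕ 4 | v &0 ∈ f (Nat.pair (v &2) (v &1))} :=
      dioph_comp2 (S := fun a b => b ∈ f a) (pair_dioph (D&2) (D&1)) (D&0) hf
    refine (h1 D∧ vec_ball_dioph ((D∃) 3 <| h2 D∧ D&0 D≠ D.0) (D&1)).ext ?_
    refine (vectorAll_iff_forall _).1 fun x z => ?_
    exact (rfind_iff f x z).symm
end

end Diophantine

/-- Integer polynomial expression trees over variables indexed by naturals. -/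
inductive PE : Type
  | var (n : ℕ) : PE
  | const (c : ℤ) : PE
  | sub (a b : PE) : PE
  | mul (a b : PE) : PE

/-- Value of an expression. -/
def PE.val (t : ℕ → ℕ) : PE → ℤ
  | .var n => t n
  | .const c => c
  | .sub a b => PE.val t a - PE.val t b
  | .mul a b => PE.val t a * PE.val t b

/-- Injective coding of expressions. -/
def PE.code : PE → ℕ
  | .var n => Nat.pair 0 n
  | .const c => Nat.pair 1 (Encodable.encode c)
  | .sub a b => Nat.pair 2 (Nat.pair (PE.code a) (PE.code b))
  | .mul a b => Nat.pair 3 (Nat.pair (PE.code a) (PE.code b))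

lemma PE.code_inj : ∀ a b : PE, a.code = b.code → a = b := by
  intro a
  induction a with
  | var n => intro b h; cases b <;> simp_all [PE.code, Nat.pair_eq_pair]
  | const n => intro b h; cases b <;> simp_all [PE.code, Nat.pair_eq_pair]
  | sub a1 a2 h1 h2 =>
    intro b h
    cases b <;> simp [PE.code, Nat.pair_eq_pair] at h
    rw [h1 _ h.1, h2 _ h.2]
  | mul a1 a2 h1 h2 =>
    intro b h
    cases b <;> simp [PE.code, Nat.pair_eq_pair] at h
    rw [h1 _ h.1, h2 _ h.2]

lemma poly_PE {γ : Type} (g : γ → ℕ) (p : Poly γ) :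
    ∃ e : PE, ∀ t : ℕ → ℕ, e.val t = p (fun i => t (g i)) := by
  induction p using Poly.induction with
  | H1 i => exact ⟨.var (g i), fun t => by simp [PE.val]⟩
  | H2 n => exact ⟨.const n, fun t => by simp [PE.val]⟩
  | H3 f h hf hh =>
    obtain ⟨e, he⟩ := hf
    obtain ⟨e', he'⟩ := hh
    exact ⟨.sub e e', fun t => by simp [PE.val, he, he']⟩
  | H4 f h hf hh =>
    obtain ⟨e, he⟩ := hf
    obtain ⟨e', he'⟩ := hh
    exact ⟨.mul e e', fun t => by simp [PE.val, he, he']⟩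

lemma poly_solv {γ : Type} (p : Poly γ) (i0 : γ) :
    ∃ (e : PE) (n0 : ℕ), ∀ a : ℕ, (∃ v : γ → ℕ, v i0 = a ∧ p v = 0) ↔
      ∃ t : ℕ → ℕ, t n0 = a ∧ e.val t = 0 := by
  classical
  obtain ⟨s, C, d, h1, -⟩ := poly_aux p
  obtain ⟨f, hf⟩ := exists_injective_nat (insert i0 s : Finset γ)
  let g : γ → ℕ := fun x => if h : x ∈ insert i0 s then f ⟨x, h⟩ else 0
  have hg : Set.InjOn g (insert i0 s : Finset γ) := by
    intro x hx y hy hxy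
    have hx' : x ∈ insert i0 s := hx
    have hy' : y ∈ insert i0 s := hy
    simp only [g, dif_pos hx', dif_pos hy'] at hxy
    simpa using hf hxy
  obtain ⟨e, he⟩ := poly_PE g p
  refine ⟨e, g i0, fun a => ⟨?_, ?_⟩⟩
  · rintro ⟨v, hv, hp⟩
    have : Nonempty γ := ⟨i0⟩
    have hl := hg.leftInvOn_invFunOn
    refine ⟨fun n => v (Function.invFunOn g (insert i0 s : Finset γ) n), ?_, ?_⟩
    · have := hl (show i0 ∈ ((insert i0 s : Finset γ) : Set γ) by simp)
      simp only [this, hv]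
    · rw [he, ← hp]
      have := h1 (fun i => v (Function.invFunOn g (insert i0 s : Finset γ) (g i))) v 0 (by
        intro i hi
        have := hl (show i ∈ ((insert i0 s : Finset γ) : Set γ) by simp [hi])
        simp only [this]; rfl)
      simpa [Int.modEq_zero_iff] using this
  · rintro ⟨t, ht, hp⟩
    exact ⟨fun i => t (g i), ht, by rw [← he, hp]⟩

theorem halting_PE : ∃ (e : PE) (n0 : ℕ), ∀ a : ℕ,
    (Nat.Partrec.Code.eval (Denumerable.ofNat Nat.Partrec.Code a) 0).Dom ↔
      ∃ t : ℕ → ℕ, t n0 = a ∧ e.val t = 0 := by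
  have hF : Nat.Partrec (fun a : ℕ =>
      Nat.Partrec.Code.eval (Denumerable.ofNat Nat.Partrec.Code a) 0) := by
    refine Partrec.nat_iff.1 ?_
    exact Nat.Partrec.Code.eval_part.comp (Computable.ofNat Nat.Partrec.Code)
      (Computable.const 0)
  obtain ⟨β, p, hp⟩ := partrec_dioph hF
  obtain ⟨e, n0, h⟩ := poly_solv p (Sum.inl (Fin2.fz : Fin2 2))
  refine ⟨e, n0, fun a => ?_⟩
  rw [← h, Part.dom_iff_mem]
  constructor
  · rintro ⟨z, hz⟩
    obtain ⟨t, ht⟩ := (hp (Vector3.cons a (Vector3.cons z Vector3.nil))).1 hz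
    exact ⟨_, rfl, ht⟩
  · rintro ⟨v, hv, h0⟩
    have := (hp (fun i => v (Sum.inl i))).2 ⟨fun i => v (Sum.inr i), by
      rw [← h0]; congr 1; funext i; cases i <;> rfl⟩
    subst hv
    exact ⟨_, this⟩

/-- A guard comparing the value zero with `c + a1 p0 + a2 p1 + a3 p2 + a4 p3`. -/
def mkG (ge : Bool) (c : ℤ) (a1 a2 a3 a4 : Coeff) : SGuard :=
  (.inl 1, 0, ge, .inl c, [a1, a2, a3, a4])

/-- Environment valuations in which the last three variables are one. -/
def Good (p : ℕ → ℕ) : Prop := p 1 = 1 ∧ p 2 = 1 ∧ p 3 = 1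

/-- The environment of the reduction. -/
def E0 : Env := (4, [([0, 1], -1), ([0, -1], 1), ([0, 0, 1], -1), ([0, 0, -1], 1),
  ([0, 0, 0, 1], -1), ([0, 0, 0, -1], 1)], ([], 1))

/-- The rule given by a list of guards. -/
def mkR (gs : List SGuard) : SRule := (0, 1, gs, [])

/-- The sketch given by a list of guard lists. -/
def mkTA (R : List (List SGuard)) : Sketch := (2, [0], 1, R.map mkR)

lemma acyc (R : List (List SGuard)) : SketchAcyclic (mkTA R) := by
  intro a h
  have key : ∀ x y, Relation.TransGen
      (fun u w => ∃ r ∈ (mkTA R).2.2.2, r.1 = u ∧ r.2.1 = w) x y → x = 0 ∧ y = 1 := by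
    intro x y h
    induction h with
    | single h =>
      obtain ⟨r, hr, h1, h2⟩ := h
      simp only [mkTA, List.mem_map] at hr
      obtain ⟨gs, -, rfl⟩ := hr
      exact ⟨h1.symm, h2.symm⟩
    | tail _ h ih =>
      obtain ⟨r, hr, h1, h2⟩ := h
      simp only [mkTA, List.mem_map] at hr
      obtain ⟨gs, -, rfl⟩ := hr
      exact ⟨ih.1, h2.symm⟩
  have := key a a h
  omega

lemma rc_iff (p : ℕ → ℕ) : (∀ c ∈ E0.2.1, 0 ≤ LinExpr.evalAt c p) ↔ Good p := by
  simp [E0, LinExpr.evalAt, Finset.sum_range_succ, Good]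
  omega

/-- No rule in the list can ever fire. -/
def OK (μ : ℕ → ℤ) (R : List (List SGuard)) : Prop :=
  ∀ p, Good p → ∀ gs ∈ R, ¬ ∀ gd ∈ gs, SGuard.sat μ (fun _ => 0) p gd

lemma not_covers_iff (μ : ℕ → ℤ) (R : List (List SGuard)) :
    (¬ Covers E0 (mkTA R) μ 1) ↔ OK μ R := by
  constructor
  · intro h p hp gs hgs hall
    apply h
    refine ⟨⟨fun i => if i = 0 then 1 else 0, fun _ => 0, p⟩,
      ⟨fun i => if i = 1 then 1 else 0, fun _ => 0, p⟩, ⟨⟨(rc_iff p).2 hp, ?_, ?_⟩, ?_, ?_⟩,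
      Relation.ReflTransGen.single ⟨mkR gs, ?_, ?_, hall, ?_, ?_, ?_⟩, ?_⟩
    · simp [mkTA, E0, LinExpr.evalAt]
    · intro i hi
      have : 2 ≤ i := hi
      simp; omega
    · intro i hi
      simpa [mkTA] using hi
    · intro j; rfl
    · exact List.mem_map_of_mem hgs
    · simp [mkR]
    · intro i; rfl
    · intro i; simp [mkR]
    · intro i
      simp only [mkR]
      split_ifs <;> omega
    · simp
  · rintro h ⟨C, C', ⟨⟨h1, h2, h3⟩, h4, h5⟩, hs, hpos⟩
    have hg : C.g = fun _ => 0 := funext h5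
    rcases Relation.ReflTransGen.cases_head hs with h0 | ⟨D, hD, -⟩
    · subst h0
      have := h4 1 (by simp [mkTA])
      omega
    · obtain ⟨r, hr, -, hall, -⟩ := hD
      simp only [mkTA, List.mem_map] at hr
      obtain ⟨gs, hgs, rfl⟩ := hr
      rw [hg] at hall
      exact h C.p ((rc_iff _).1 h1) gs hgs hall

lemma OK_append (μ : ℕ → ℤ) (R S : List (List SGuard)) :
    OK μ (R ++ S) ↔ OK μ R ∧ OK μ S := by
  simp only [OK, List.mem_append]
  constructor
  · intro h
    exact ⟨fun p hp gs hg => h p hp gs (Or.inl hg), fun p hp gs hg => h p hp gs (Or.inr hg)⟩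
  · rintro ⟨h, h'⟩ p hp gs (hg | hg)
    · exact h p hp gs hg
    · exact h' p hp gs hg

lemma sat_mkG (μ : ℕ → ℤ) (p : ℕ → ℕ) (hp : Good p) (ge : Bool) (c : ℤ) (a1 a2 a3 a4 : Coeff) :
    SGuard.sat μ (fun _ => 0) p (mkG ge c a1 a2 a3 a4) ↔
      if ge then c + a1.eval μ * p 0 + a2.eval μ + a3.eval μ + a4.eval μ ≤ 0
      else 0 < c + a1.eval μ * p 0 + a2.eval μ + a3.eval μ + a4.eval μ := by
  obtain ⟨h1, h2, h3⟩ := hp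
  simp [SGuard.sat, mkG, Finset.sum_range_succ, h1, h2, h3, Coeff.eval, add_assoc]

/-- Rules firing when the conditions hold and the linear form is nonzero. -/
def eqR (cs : List SGuard) (c c' : ℤ) (a1 a2 a3 a4 : Coeff) : List (List SGuard) :=
  [mkG false c a1 a2 a3 a4 :: cs, mkG true c' a1 a2 a3 a4 :: cs]

lemma OK_eqR (μ : ℕ → ℤ) (cs : List SGuard) (c c' : ℤ) (hc : c' = c + 1) (a1 a2 a3 a4 : Coeff) :
    OK μ (eqR cs c c' a1 a2 a3 a4) ↔
      ∀ p, Good p → (∀ gd ∈ cs, SGuard.sat μ (fun _ => 0) p gd) →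
        c + a1.eval μ * p 0 + a2.eval μ + a3.eval μ + a4.eval μ = 0 := by
  unfold OK
  refine forall_congr' fun p => forall_congr' fun hp => ?_
  simp only [eqR, List.mem_cons, List.not_mem_nil, or_false, forall_eq_or_imp, forall_eq,
    sat_mkG μ p hp]
  generalize (∀ gd ∈ cs, SGuard.sat μ (fun _ => 0) p gd) = Q
  by_cases hcs : Q
  · simp [hcs]
    omega
  · simp [hcs]

lemma good_one (P : ℕ) : Good (fun i => if i = 0 then P else 1) := by simp [Good]

lemma OK_eq0 (μ : ℕ → ℤ) (c c' : ℤ) (hc : c' = c + 1) (a2 a3 a4 : Coeff) :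
    OK μ (eqR [] c c' (.inl 0) a2 a3 a4) ↔ c + a2.eval μ + a3.eval μ + a4.eval μ = 0 := by
  rw [OK_eqR _ _ _ _ hc]
  constructor
  · intro h
    simpa [Coeff.eval] using h _ (good_one 0) (by simp)
  · intro h p _ _
    simpa [Coeff.eval] using h

/-- The condition that the first environment variable equals an indeterminate. -/
def condG (x : ℕ) : List SGuard :=
  [mkG true 0 (.inl (-1)) (.inr x) (.inl 0) (.inl 0),
   mkG false 1 (.inl (-1)) (.inr x) (.inl 0) (.inl 0)]

lemma OK_mul (μ : ℕ → ℤ) (x y z : ℕ) :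
    OK μ (eqR (condG x) 0 1 (.inr y) (.inr z) (.inl 0) (.inl 0)) ↔
      (0 ≤ μ x → μ y * μ x + μ z = 0) := by
  rw [OK_eqR _ _ _ _ (by norm_num)]
  have hc : ∀ p, Good p → ((∀ gd ∈ condG x, SGuard.sat μ (fun _ => 0) p gd) ↔ (p 0 : ℤ) = μ x) := by
    intro p hp
    simp only [condG, List.mem_cons, List.not_mem_nil, or_false, forall_eq_or_imp, forall_eq,
      sat_mkG μ p hp]
    simp [Coeff.eval]
    omega
  constructor
  · intro h hx
    have := h _ (good_one (μ x).toNat) ((hc _ (good_one _)).2 (by simp [hx]))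
    simpa [Coeff.eval, hx] using this
  · intro h p hp hcs
    rw [hc p hp] at hcs
    have := h (by omega)
    rw [← hcs] at this
    simpa [Coeff.eval] using this

/-- Indeterminate holding the value of an expression. -/
def PE.idx (e : PE) : ℕ := 2 * e.code
/-- Indeterminate holding the negated value of an expression. -/
def PE.nidx (e : PE) : ℕ := 2 * e.code + 1

lemma PE.idx_code {a b : PE} (h : a.idx = b.idx) : a.code = b.code := by
  unfold PE.idx at h; omega

lemma PE.nidx_code {a b : PE} (h : a.nidx = b.nidx) : a.code = b.code := by
  unfold PE.nidx at h; omega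

/-- The rule enforcing that the two indeterminates of a node are opposite. -/
def baseR (e : PE) : List (List SGuard) :=
  eqR [] 0 1 (.inl 0) (.inr e.idx) (.inr e.nidx) (.inl 0)

/-- All the rules enforcing correct values for the nodes of an expression. -/
def PE.rules : PE → List (List SGuard)
  | .var n => baseR (.var n) ++
      [[mkG true 1 (.inl 0) (.inr (PE.idx (.var n))) (.inl 0) (.inl 0)]]
  | .const c => baseR (.const c) ++
      eqR [] (-c) (-c + 1) (.inl 0) (.inr (PE.idx (.const c))) (.inl 0) (.inl 0)
  | .sub a b => baseR (.sub a b) ++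
      (eqR [] 0 1 (.inl 0) (.inr (PE.nidx (.sub a b))) (.inr a.idx) (.inr b.nidx) ++
      (PE.rules a ++ PE.rules b))
  | .mul a b => baseR (.mul a b) ++
      (eqR (condG a.idx) 0 1 (.inr b.idx) (.inr (PE.nidx (.mul a b))) (.inl 0) (.inl 0) ++
      (eqR (condG a.nidx) 0 1 (.inr b.idx) (.inr (PE.idx (.mul a b))) (.inl 0) (.inl 0) ++
      (PE.rules a ++ PE.rules b)))

lemma OK_base (μ : ℕ → ℤ) (e : PE) : OK μ (baseR e) ↔ μ e.nidx = - μ e.idx := by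
  rw [baseR, OK_eq0 _ _ _ (by norm_num)]
  simp [Coeff.eval]
  omega

lemma OK_nonneg (μ : ℕ → ℤ) (x : ℕ) :
    OK μ [[mkG true 1 (.inl 0) (.inr x) (.inl 0) (.inl 0)]] ↔ 0 ≤ μ x := by
  constructor
  · intro h
    have := h _ (good_one 0) _ List.mem_cons_self
    simp only [List.mem_cons, List.not_mem_nil, or_false, forall_eq,
      sat_mkG μ _ (good_one 0)] at this
    simp [Coeff.eval] at this
    omega
  · intro h p hp gs hgs
    simp only [List.mem_cons, List.not_mem_nil, or_false] at hgs
    subst hgs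
    simp only [List.mem_cons, List.not_mem_nil, or_false, forall_eq, sat_mkG μ _ hp]
    simp [Coeff.eval]
    omega

lemma rules_sound (μ : ℕ → ℤ) : ∀ e : PE, OK μ e.rules →
    μ e.idx = e.val (fun n => (μ (PE.idx (.var n))).toNat) ∧ μ e.nidx = - μ e.idx := by
  intro e
  induction e with
  | var n =>
    intro h
    rw [PE.rules, OK_append, OK_base, OK_nonneg] at h
    exact ⟨by simp [PE.val, h.2], h.1⟩
  | const c =>
    intro h
    rw [PE.rules, OK_append, OK_base, OK_eq0 _ _ _ rfl] at h
    refine ⟨?_, h.1⟩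
    have := h.2
    simp [Coeff.eval] at this
    simp [PE.val]; omega
  | sub a b ha hb =>
    intro h
    rw [PE.rules, OK_append, OK_append, OK_append, OK_base, OK_eq0 _ _ _ (by norm_num)] at h
    obtain ⟨h1, h2, h3, h4⟩ := h
    obtain ⟨ha1, ha2⟩ := ha h3
    obtain ⟨hb1, hb2⟩ := hb h4
    refine ⟨?_, h1⟩
    simp [Coeff.eval] at h2
    simp only [PE.val]
    omega
  | mul a b ha hb =>
    intro h
    rw [PE.rules, OK_append, OK_append, OK_append, OK_append, OK_base, OK_mul, OK_mul] at h
    obtain ⟨h1, h2, h2', h3, h4⟩ := h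
    obtain ⟨ha1, ha2⟩ := ha h3
    obtain ⟨hb1, hb2⟩ := hb h4
    refine ⟨?_, h1⟩
    simp only [PE.val]
    rw [← ha1, ← hb1]
    rcases le_total 0 (μ a.idx) with h0 | h0
    · have := h2 h0
      rw [h1] at this
      linarith [mul_comm (μ a.idx) (μ b.idx)]
    · have := h2' (by rw [ha2]; omega)
      rw [ha2] at this
      linarith [mul_comm (μ a.idx) (μ b.idx)]

lemma rules_complete (μ : ℕ → ℤ) (t : ℕ → ℕ) (h1 : ∀ e : PE, μ e.idx = e.val t)
    (h2 : ∀ e : PE, μ e.nidx = - e.val t) : ∀ e : PE, OK μ e.rules := by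
  intro e
  induction e with
  | var n =>
    rw [PE.rules, OK_append, OK_base, OK_nonneg, h1, h2]
    simp [PE.val]
  | const c =>
    rw [PE.rules, OK_append, OK_base, OK_eq0 _ _ _ rfl]
    simp [Coeff.eval, h1, h2, PE.val]
  | sub a b ha hb =>
    rw [PE.rules, OK_append, OK_append, OK_append, OK_base, OK_eq0 _ _ _ (by norm_num)]
    refine ⟨by simp [h1, h2], ?_, ha, hb⟩
    simp [Coeff.eval, h1, h2, PE.val]
  | mul a b ha hb =>
    rw [PE.rules, OK_append, OK_append, OK_append, OK_append, OK_base, OK_mul, OK_mul]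
    refine ⟨by simp [h1, h2], fun _ => ?_, fun _ => ?_, ha, hb⟩
    · simp only [h1, h2, PE.val]; ring
    · simp only [h1, h2, PE.val]; ring

/-- The fixed part of the reduction. -/
def fixedR (e : PE) (n0 : ℕ) : List (List SGuard) :=
  e.rules ++ (PE.rules (.var n0) ++
    eqR [] 0 1 (.inl 0) (.inr e.idx) (.inl 0) (.inl 0))

/-- All the rules of the reduction. -/
def allR (e : PE) (n0 a : ℕ) : List (List SGuard) :=
  eqR [] (a : ℤ) ((a + 1 : ℕ) : ℤ) (.inl 0) (.inr (PE.nidx (.var n0))) (.inl 0) (.inl 0) ++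
    fixedR e n0

lemma exists_OK_iff (e : PE) (n0 a : ℕ) :
    (∃ μ : ℕ → ℤ, OK μ (allR e n0 a)) ↔ ∃ t : ℕ → ℕ, t n0 = a ∧ e.val t = 0 := by
  constructor
  · rintro ⟨μ, h⟩
    rw [allR, fixedR, OK_append, OK_append, OK_append, OK_eq0 _ _ _ (by push_cast; rfl),
      OK_eq0 _ _ _ (by norm_num)] at h
    obtain ⟨h1, h2, h3, h4⟩ := h
    obtain ⟨hv, hn⟩ := rules_sound μ _ h3
    obtain ⟨he, -⟩ := rules_sound μ _ h2
    simp [Coeff.eval] at h1 h4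
    refine ⟨_, ?_, he.symm.trans h4⟩
    omega
  · rintro ⟨t, ht, h0⟩
    classical
    let μ : ℕ → ℤ := fun k =>
      if h : ∃ e : PE, e.idx = k then (Classical.choose h).val t
      else if h : ∃ e : PE, e.nidx = k then - (Classical.choose h).val t else 0
    have h1 : ∀ e : PE, μ e.idx = e.val t := by
      intro e
      have hex : ∃ e' : PE, e'.idx = e.idx := ⟨e, rfl⟩
      have hs := Classical.choose_spec hex
      have : Classical.choose hex = e := PE.code_inj _ _ (PE.idx_code hs)
      simp only [μ, dif_pos hex, this]
    have h2 : ∀ e : PE, μ e.nidx = - e.val t := by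
      intro e
      have hno : ¬ ∃ e' : PE, e'.idx = e.nidx := by
        rintro ⟨e', h⟩
        unfold PE.idx PE.nidx at h; omega
      have hex : ∃ e' : PE, e'.nidx = e.nidx := ⟨e, rfl⟩
      have hs := Classical.choose_spec hex
      have : Classical.choose hex = e := PE.code_inj _ _ (PE.nidx_code hs)
      simp only [μ, dif_neg hno, dif_pos hex, this]
    refine ⟨μ, ?_⟩
    rw [allR, fixedR, OK_append, OK_append, OK_append, OK_eq0 _ _ _ (by push_cast; rfl),
      OK_eq0 _ _ _ (by norm_num)]
    refine ⟨?_, rules_complete μ t h1 h2 _, rules_complete μ t h1 h2 _, ?_⟩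
    · simp [Coeff.eval, h2, PE.val, ht]
    · simp [Coeff.eval, h1, h0]

/-- The instance produced by the reduction. -/
def inst (e : PE) (n0 a : ℕ) : Instance := (E0, mkTA (allR e n0 a), 1)

lemma cast_primrec : Primrec (fun a : ℕ => (a : ℤ)) := by
  rw [← Primrec.encode_iff]
  exact (Primrec.nat_mul.comp (Primrec.const 2) Primrec.id).of_eq fun n => rfl

lemma mkR_primrec (ge : Bool) (n0 : ℕ) : Primrec (fun a : ℕ =>
    mkR [mkG ge (a : ℤ) (.inl 0) (.inr n0) (.inl 0) (.inl 0)]) := by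
  have hc : Primrec (fun a : ℕ => (Sum.inl (a : ℤ) : Coeff)) := Primrec.sumInl.comp cast_primrec
  have hg : Primrec (fun a : ℕ => mkG ge (a : ℤ) (.inl 0) (.inr n0) (.inl 0) (.inl 0)) :=
    Primrec.pair (Primrec.const _) (Primrec.pair (Primrec.const _)
      (Primrec.pair (Primrec.const _) (Primrec.pair hc (Primrec.const _))))
  exact Primrec.pair (Primrec.const _) (Primrec.pair (Primrec.const _)
    (Primrec.pair (Primrec.list_cons.comp hg (Primrec.const [])) (Primrec.const [])))

lemma inst_primrec (e : PE) (n0 : ℕ) : Primrec (inst e n0) := by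
  have h1 := mkR_primrec false (PE.nidx (.var n0))
  have h2 := (mkR_primrec true (PE.nidx (.var n0))).comp Primrec.succ
  have hR := Primrec.list_cons.comp h1
    (Primrec.list_cons.comp h2 (Primrec.const ((fixedR e n0).map mkR)))
  exact Primrec.pair (Primrec.const _) (Primrec.pair (Primrec.pair (Primrec.const _)
    (Primrec.pair (Primrec.const _) (Primrec.pair (Primrec.const _) hR))) (Primrec.const _))

/-- **Coefficient synthesis is undecidable** (Theorem 1): there is no algorithm
that, given an environment `Env`, a sketch threshold automaton `TA` over `Env`
and a location `ℓ` of `TA`, decides whether there exists an integer assignment `μ`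
to the indeterminates such that `TA[μ]` cannot cover `ℓ` — even when the input
sketch is required to be acyclic. -/
theorem coefficient_synthesis_undecidable :
    ¬ ∃ f : Instance → Bool, Computable f ∧
      ∀ inst : Instance, SketchAcyclic inst.2.1 → inst.2.2 < inst.2.1.1 →
        (f inst = true ↔
          ∃ μ : ℕ → ℤ, ¬ Covers inst.1 inst.2.1 μ inst.2.2) := by
  rintro ⟨f, hf, h⟩
  obtain ⟨e, n0, he⟩ := halting_PE
  refine ComputablePred.halting_problem 0 ?_
  rw [ComputablePred.computable_iff]
  refine ⟨fun c => f (inst e n0 (Encodable.encode c)),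
    hf.comp ((inst_primrec e n0).to_comp.comp Computable.encode), ?_⟩
  funext c
  have h1 := he (Encodable.encode c)
  rw [Denumerable.ofNat_encode] at h1
  rw [h1, ← exists_OK_iff]
  rw [h (inst e n0 (Encodable.encode c)) (acyc _) (by simp [inst, mkTA])]
  simp only [inst, not_covers_iff]

end ThresholdAutomata
end

section
/- The validity problem for the fragment ∀∃_R PAD⁺ of Presburger arithmetic with divisibility, interpreted over the natural numbers, is undecidable: there is no algorithm that, given a sentence of the form ∀x₁,…,xₙ ∃y₁,…,y_m ⋁_{i∈I}(⋀_{(j,k)∈S_i} x_j | y_k ∧ ⋀_{l∈B_i} A_l(x,y)), decides whether it holds over ℕ. -/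
namespace PAD

/-- A linear polynomial `Σᵢ aᵢ·vᵢ + c` with `ℕ` coefficients over the variables
`v₀, v₁, …` (given as the list `[a₀, a₁, …]` of coefficients and the constant `c`). -/
abbrev LinPoly : Type := List ℕ × ℕ

/-- The value of a linear polynomial at a valuation `v` of the variables. -/
def evalPoly (f : LinPoly) (v : ℕ → ℕ) : ℕ :=
  f.2 + ∑ i ∈ Finset.range f.1.length, f.1.getD i 0 * v i

/-- An atomic Presburger formula `p ⋈ q`, where `⋈ ∈ {<, ≤, =, >, ≥}` is coded
by a number `0, 1, 2, 3, 4` respectively. -/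
abbrev AtomF : Type := LinPoly × ℕ × LinPoly

/-- Interpretation of the coded comparison operators on `ℕ`. -/
def cmpHolds : ℕ → ℕ → ℕ → Prop
  | 0, a, b => a < b
  | 1, a, b => a ≤ b
  | 2, a, b => a = b
  | 3, a, b => a > b
  | _, a, b => a ≥ b

/-- Truth of an atomic Presburger formula at a valuation `v` of the variables. -/
def atomHolds (A : AtomF) (v : ℕ → ℕ) : Prop :=
  cmpHolds A.2.1 (evalPoly A.1 v) (evalPoly A.2.2 v)

/-- A disjunct `⋀_{(j,k)∈S} (x_j | y_k) ∧ ⋀_{l∈B} A_l(x,y)` of a `∀∃_R PAD⁺`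
sentence: a finite list `S` of pairs `(j,k)` of variable indices (a divisibility
constraint `x_j | y_k` for each) and a finite list `B` of quantifier-free atomic
Presburger formulas over the variables `x₁, …, xₙ, y₁, …, y_m`. -/
abbrev Disjunct : Type := List (ℕ × ℕ) × List AtomF

/-- A `∀∃_R PAD⁺` sentence `∀x₁,…,xₙ ∃y₁,…,y_m ⋁_{i∈I} ξᵢ`, given as the
triple `(n, m, [disjuncts])`. In the atomic formulas, the variables
`x₁, …, xₙ` have the indices `0, …, n-1` and the variables `y₁, …, y_m` have
the indices `n, …, n+m-1`. -/
abbrev Sentence : Type := ℕ × ℕ × List Disjunct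

/-- Truth of a `∀∃_R PAD⁺` sentence over `ℕ`: for every assignment `X` to the
`x`-variables there is an assignment `Y` to the `y`-variables and a disjunct all
of whose divisibility constraints `x_j | y_k` and atomic formulas hold. -/
def SentenceHolds (s : Sentence) : Prop :=
  ∀ X : ℕ → ℕ, ∃ Y : ℕ → ℕ, ∃ dj ∈ s.2.2,
    (∀ jk ∈ dj.1, X jk.1 ∣ Y jk.2) ∧
    (∀ A ∈ dj.2, atomHolds A (fun i => if i < s.1 then X i else Y (i - s.1)))

section ArithmeticPart
open Nat


lemma choose_digit (n k : ℕ) :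
    n.choose k = ((2 ^ n + 1 + 1) ^ n / (2 ^ n + 1) ^ k) % (2 ^ n + 1) := by
  have hB : 0 < 2 ^ n + 1 := by positivity
  have hlt : ∀ i, n.choose i < 2 ^ n + 1 := fun i => Nat.lt_succ_of_le (Nat.choose_le_two_pow n i)
  generalize 2 ^ n + 1 = B at *
  rcases Nat.lt_or_ge n k with h | h
  · rw [Nat.choose_eq_zero_of_lt h]
    rw [Nat.div_eq_of_lt]
    · simp
    · -- all digits up to n; (B+1)^n < B^(n+1) needs digit bound
      have key : ∀ m, ∑ i ∈ Finset.range m, B ^ i * n.choose i < B ^ m := by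
        intro m
        induction m with
        | zero => simp
        | succ m ih =>
          rw [Finset.sum_range_succ, pow_succ]
          have := hlt m
          have : B ^ m * (n.choose m + 1) ≤ B ^ m * B := Nat.mul_le_mul_left _ this
          rw [mul_add] at this
          omega
      have e : (B + 1) ^ n = ∑ i ∈ Finset.range (n + 1), B ^ i * n.choose i := by
        rw [add_pow]; simp
      rw [e]
      exact (key _).trans_le (Nat.pow_le_pow_right hB h)
  · have key : ∀ m, ∑ i ∈ Finset.range m, B ^ i * n.choose i < B ^ m := by
      intro m
      induction m with
      | zero => simp
      | succ m ih =>
        rw [Finset.sum_range_succ, pow_succ]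
        have := hlt m
        have : B ^ m * (n.choose m + 1) ≤ B ^ m * B := Nat.mul_le_mul_left _ this
        rw [mul_add] at this
        omega
    obtain ⟨d, rfl⟩ := Nat.exists_eq_add_of_le h
    have e : (B + 1) ^ (k + d) = ∑ i ∈ Finset.range k, B ^ i * (k + d).choose i +
        B ^ k * ((k + d).choose k +
          B * ∑ i ∈ Finset.range d, B ^ i * (k + d).choose (k + 1 + i)) := by
      rw [add_pow]
      simp only [one_pow, mul_one]
      rw [show k + d + 1 = (k + 1) + d by ring, Finset.sum_range_add, Finset.sum_range_succ,
        mul_add, add_assoc, Finset.mul_sum, Finset.mul_sum]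
      congr 2
      apply Finset.sum_congr rfl
      intros; push_cast; ring_nf
    rw [e, Nat.add_mul_div_left _ _ (by positivity), Nat.div_eq_of_lt (key k), zero_add,
      Nat.add_mul_mod_self_left, Nat.mod_eq_of_lt (hlt k)]

lemma factorial_formula (n : ℕ) :
    n ! = ((n + 2) ^ (n + 4)) ^ n / ((n + 2) ^ (n + 4)).choose n := by
  set r := (n + 2) ^ (n + 4) with hr
  have hf : n ! ≤ (n + 2) ^ n := (Nat.factorial_le_pow n).trans (Nat.pow_le_pow_left (by omega) n)
  have hr1 : n * n * (n ! + 1) < r := by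
    have : r = (n + 2) ^ n * ((n + 2) ^ 4) := by rw [hr, pow_add]
    rw [this]
    have h1 : n ! + 1 ≤ 2 * (n + 2) ^ n := by
      have : 1 ≤ (n + 2) ^ n := Nat.one_le_pow _ _ (by omega)
      omega
    have h2 : n * n * 2 < (n + 2) ^ 4 := by nlinarith [sq_nonneg n, sq_nonneg (n*n)]
    have h3 : 0 < (n + 2) ^ n := by positivity
    calc n * n * (n ! + 1) ≤ n * n * (2 * (n + 2) ^ n) := Nat.mul_le_mul_left _ h1
      _ = (n + 2) ^ n * (n * n * 2) := by ring
      _ < _ := Nat.mul_lt_mul_of_pos_left h2 h3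
  have hnr : n ≤ r := by nlinarith [Nat.factorial_pos n]
  have hC : 0 < r.choose n := Nat.choose_pos hnr
  have hd : n ! * r.choose n = r.descFactorial n := (Nat.descFactorial_eq_factorial_mul_choose r n).symm
  symm
  rw [Nat.div_eq_iff hC]
  have h1 : r.descFactorial n ≤ r ^ n := Nat.descFactorial_le_pow r n
  have h2 : (r + 1 - n) ^ n ≤ r.descFactorial n := Nat.pow_sub_le_descFactorial r n
  have h3 : r ^ n ≤ r.descFactorial n + n * n * r ^ (n - 1) := by
    rcases n with _ | k
    · simp
    have hb : ((r : ℤ) - (k+1)) ^ (k+1) ≥ r ^ (k+1) - (k+1) * (k+1) * r ^ k := by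
      have aux : ∀ m : ℕ, ((r : ℤ) - (k+1)) ^ (m+1) ≥ r ^ (m+1) - (m+1) * (k+1) * r ^ m := by
        intro m
        induction m with
        | zero => simp
        | succ m ih =>
          have hnn : (0 : ℤ) ≤ (r : ℤ) - (k + 1) := by
            have : ((k + 1 : ℕ) : ℤ) ≤ r := by exact_mod_cast hnr
            push_cast at this; omega
          have := mul_le_mul_of_nonneg_right ih hnn
          rw [pow_succ _ (m+1)]
          refine le_trans ?_ this
          have hp : (0 : ℤ) ≤ (m+1) * (k+1) * (k+1) * r ^ m := by positivity
          push_cast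
          ring_nf at hp ⊢
          nlinarith
      have := aux k
      exact_mod_cast this
    have h2' : ((r : ℤ) - (k+1)) ^ (k+1) ≤ r.descFactorial (k+1) := by
      have : (r - (k+1)) ^ (k+1) ≤ r.descFactorial (k+1) :=
        (Nat.pow_le_pow_left (by omega) _).trans h2
      zify [hnr] at this
      simpa using this
    have : (r : ℤ) ^ (k+1) ≤ r.descFactorial (k+1) + (k+1) * (k+1) * r ^ k := by linarith
    exact_mod_cast this
  constructor
  · rw [hd]; exact h1
  · rw [hd]
    suffices n * n * r ^ (n-1) < r.choose n by omega
    have hn0 : 0 < n ! := Nat.factorial_pos n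
    refine lt_of_mul_lt_mul_left (a := n !) ?_ (Nat.zero_le _)
    rw [hd]
    rcases n with _ | k
    · simp
    simp only [Nat.add_sub_cancel] at h3 ⊢
    have hrk : 0 < r ^ k := by positivity
    have := Nat.mul_lt_mul_of_pos_right hr1 hrk
    rw [pow_succ] at h3
    nlinarith

section
variable {α β : Type}
open Dioph
open scoped Dioph

lemma dioph_choose {f g : (α → ℕ) → ℕ} (df : DiophFn f) (dg : DiophFn g) :
    DiophFn fun v => (f v).choose (g v) := by
  simp only [choose_digit]
  have h2 : DiophFn fun v => 2 ^ f v + 1 := add_dioph (pow_dioph (const_dioph 2) df) (const_dioph 1)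
  exact mod_dioph (div_dioph (pow_dioph (add_dioph h2 (const_dioph 1)) df) (pow_dioph h2 dg)) h2

lemma dioph_factorial {f : (α → ℕ) → ℕ} (df : DiophFn f) : DiophFn fun v => (f v)! := by
  simp only [factorial_formula]
  have h2 : DiophFn fun v => (f v + 2) ^ (f v + 4) :=
    pow_dioph (add_dioph df (const_dioph 2)) (add_dioph df (const_dioph 4))
  exact div_dioph (pow_dioph h2 df) (dioph_choose h2 df)

lemma dioph_dex {P : (α → ℕ) → ℕ → Prop}
    (h : Dioph {w : Option α → ℕ | P (w ∘ some) (w none)}) : Dioph {v | ∃ x, P v x} :=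
  Dioph.ext (ex1_dioph h) fun _ => Iff.rfl

lemma dioph_up {f : (α → ℕ) → ℕ} (df : DiophFn f) :
    DiophFn (fun w : Option α → ℕ => f (w ∘ some)) := reindex_diophFn some df

lemma dioph_list {γ : Type} (l : List γ) {P : γ → (α → ℕ) → Prop} (h : ∀ j, Dioph {v | P j v}) :
    Dioph {v | ∀ j ∈ l, P j v} := by
  refine Dioph.ext (DiophList.forall (l.map fun j => {v | P j v}) ?_) ?_
  · rw [List.forall_iff_forall_mem]
    intro S hS
    obtain ⟨j, _, rfl⟩ := List.mem_map.1 hS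
    exact h j
  · intro v
    simp [List.forall_iff_forall_mem]

lemma poly_data (p : Poly α) : ∃ (l : List α) (c d : ℕ),
    (∀ (m : ℤ) (x y : α → ℕ), (∀ j ∈ l, (x j : ℤ) ≡ y j [ZMOD m]) → p x ≡ p y [ZMOD m]) ∧
    (∀ (w : ℕ) (x : α → ℕ), (∀ j ∈ l, x j ≤ w) → (p x).natAbs ≤ c * (w + 1) ^ d) := by
  induction p using Poly.induction with
  | H1 i =>
    refine ⟨[i], 1, 1, fun m x y h => by simpa using h, fun w x h => ?_⟩
    simp at h ⊢; omega
  | H2 n =>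
    exact ⟨[], n.natAbs, 0, fun m x y h => Int.ModEq.refl _, fun w x h => by simp⟩
  | H3 f g hf hg =>
    obtain ⟨l, c, d, h1, h2⟩ := hf
    obtain ⟨l', c', d', h1', h2'⟩ := hg
    refine ⟨l ++ l', c + c', d + d', fun m x y h => ?_, fun w x h => ?_⟩
    · exact (h1 m x y fun j hj => h j (by simp [hj])).sub (h1' m x y fun j hj => h j (by simp [hj]))
    · have a := h2 w x fun j hj => h j (by simp [hj])
      have b := h2' w x fun j hj => h j (by simp [hj])
      have e1 : (w + 1) ^ d ≤ (w + 1) ^ (d + d') := Nat.pow_le_pow_right (by omega) (by omega)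
      have e2 : (w + 1) ^ d' ≤ (w + 1) ^ (d + d') := Nat.pow_le_pow_right (by omega) (by omega)
      rw [Poly.sub_apply]
      refine (Int.natAbs_sub_le _ _).trans ?_
      rw [add_mul]
      exact Nat.add_le_add (a.trans (Nat.mul_le_mul_left _ e1)) (b.trans (Nat.mul_le_mul_left _ e2))
  | H4 f g hf hg =>
    obtain ⟨l, c, d, h1, h2⟩ := hf
    obtain ⟨l', c', d', h1', h2'⟩ := hg
    refine ⟨l ++ l', c * c', d + d', fun m x y h => ?_, fun w x h => ?_⟩
    · exact (h1 m x y fun j hj => h j (by simp [hj])).mul (h1' m x y fun j hj => h j (by simp [hj]))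
    · have a := h2 w x fun j hj => h j (by simp [hj])
      have b := h2' w x fun j hj => h j (by simp [hj])
      rw [Poly.mul_apply, Int.natAbs_mul]
      refine (Nat.mul_le_mul a b).trans (le_of_eq ?_)
      ring

/-- `C(q+n, n)` as a product of large, pairwise coprime factors. -/
lemma choose_prod (W n : ℕ) (hn : n ≤ W) :
    (W ! * W ! + n).choose n = ∏ j ∈ Finset.range n, (1 + W ! * (W ! / (j + 1))) := by
  have hn0 : 0 < n ! := Nat.factorial_pos n
  refine Nat.eq_of_mul_eq_mul_left hn0 ?_
  rw [← Nat.ascFactorial_eq_factorial_mul_choose, Nat.ascFactorial_eq_prod_range,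
    ← Finset.prod_range_add_one_eq_factorial n, ← Finset.prod_mul_distrib]
  apply Finset.prod_congr rfl
  intro j hj
  have hj' := Finset.mem_range.1 hj
  obtain ⟨k, hk⟩ : j + 1 ∣ W ! := Nat.dvd_factorial (by omega) (by omega)
  have : W ! / (j + 1) = k := by rw [hk]; exact Nat.mul_div_cancel_left _ (by omega)
  rw [this]
  conv_lhs => rw [show W ! * W ! = W ! * ((j + 1) * k) by rw [← hk]]
  ring

lemma factor_prime (W j f : ℕ) (hf : f.Prime) (h : f ∣ 1 + W ! * (W ! / (j + 1))) : W < f := by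
  by_contra hle
  have h1 : f ∣ W ! := Nat.dvd_factorial hf.pos (by omega)
  have := (Nat.dvd_add_left (Dvd.dvd.mul_right h1 _)).1 h
  exact hf.one_lt.ne' (Nat.dvd_one.1 this)

lemma factor_dvd (W j : ℕ) (hj : j < W) :
    1 + W ! * (W ! / (j + 1)) ∣ W ! * W ! + j + 1 := by
  obtain ⟨k, hk⟩ : j + 1 ∣ W ! := Nat.dvd_factorial (by omega) (by omega)
  have : W ! / (j + 1) = k := by rw [hk]; exact Nat.mul_div_cancel_left _ (by omega)
  rw [this]
  refine ⟨j + 1, ?_⟩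
  conv_lhs => rw [show W ! * W ! = W ! * ((j + 1) * k) by rw [← hk]]
  ring

lemma factor_coprime (W i j : ℕ) (hi : i < W) (hj : j < W) (hij : i ≠ j) :
    Nat.Coprime (1 + W ! * (W ! / (i + 1))) (1 + W ! * (W ! / (j + 1))) := by
  rw [Nat.coprime_iff_gcd_eq_one]
  by_contra hne
  obtain ⟨f, hf, hd⟩ := Nat.exists_prime_and_dvd hne
  have h1 := hd.trans (Nat.gcd_dvd_left _ _)
  have h2 := hd.trans (Nat.gcd_dvd_right _ _)
  have hW := factor_prime W i f hf h1
  have e1 := h1.trans (factor_dvd W i hi)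
  have e2 := h2.trans (factor_dvd W j hj)
  rcases Nat.lt_or_gt_of_ne hij with h | h
  · have := (Nat.dvd_sub e2 e1)
    have e : W ! * W ! + j + 1 - (W ! * W ! + i + 1) = j - i := by omega
    rw [e] at this
    have := Nat.le_of_dvd (by omega) this
    omega
  · have := (Nat.dvd_sub e1 e2)
    have e : W ! * W ! + i + 1 - (W ! * W ! + j + 1) = i - j := by omega
    rw [e] at this
    have := Nat.le_of_dvd (by omega) this
    omega

lemma factor_two (W j : ℕ) (hj : j < W) : 1 + W ! * (W ! / (j + 1)) ≠ 1 := by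
  have : 0 < W ! / (j + 1) := Nat.div_pos (Nat.le_of_dvd (Nat.factorial_pos W)
    (Nat.dvd_factorial (by omega) (by omega))) (by omega)
  have := Nat.mul_pos (Nat.factorial_pos W) this
  omega

lemma small_residue (f T w : ℕ) (hf : f.Prime) (h : f ∣ T.choose (w + 1)) :
    ∃ r ≤ w, (T : ℤ) ≡ r [ZMOD f] := by
  rcases Nat.lt_or_ge w T with hT | hT
  · have : f ∣ T.descFactorial (w + 1) := by
      rw [Nat.descFactorial_eq_factorial_mul_choose]; exact Dvd.dvd.mul_left h _
    rw [Nat.descFactorial_eq_prod_range, hf.prime.dvd_finsetProd_iff] at this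
    obtain ⟨r, hr, hd⟩ := this
    have hr' := Finset.mem_range.1 hr
    refine ⟨r, by omega, ?_⟩
    have : ((f : ℕ) : ℤ) ∣ ((T - r : ℕ) : ℤ) := by exact_mod_cast hd
    rw [Nat.cast_sub (by omega)] at this
    exact (Int.modEq_iff_dvd.2 this).symm
  · exact ⟨T, hT, rfl⟩

lemma small_residue' (W j T w r : ℕ) (hw : w < W) (hr : r ≤ w)
    (h : (T : ℤ) ≡ r [ZMOD (1 + W ! * (W ! / (j + 1)) : ℕ)]) :
    1 + W ! * (W ! / (j + 1)) ∣ T.choose (w + 1) := by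
  rcases Nat.lt_or_ge w T with hT | hT
  · have hco : Nat.Coprime (1 + W ! * (W ! / (j + 1))) (w + 1)! := by
      rw [Nat.coprime_iff_gcd_eq_one]
      by_contra hne
      obtain ⟨f, hf, hd⟩ := Nat.exists_prime_and_dvd hne
      have h1 := hd.trans (Nat.gcd_dvd_left _ _)
      have h2 := hd.trans (Nat.gcd_dvd_right _ _)
      have := factor_prime W j f hf h1
      have := (hf.dvd_factorial).1 h2
      omega
    refine hco.dvd_of_dvd_mul_left ?_
    rw [← Nat.descFactorial_eq_factorial_mul_choose, Nat.descFactorial_eq_prod_range]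
    have : 1 + W ! * (W ! / (j + 1)) ∣ T - r := by
      have := Int.modEq_iff_dvd.1 h.symm
      rw [← Nat.cast_sub (by omega)] at this
      exact_mod_cast this
    exact this.trans (Finset.dvd_prod_of_mem (fun i => T - i) (Finset.mem_range.2 (by omega)))
  · rw [Nat.choose_eq_zero_of_lt (by omega)]; exact dvd_zero _

lemma exists_list_bound {γ : Type} (l : List γ) (f : γ → ℕ) : ∃ w, ∀ j ∈ l, f j ≤ w :=
  ⟨(l.map f).sum, fun _ hj => List.single_le_sum (by simp) _ (List.mem_map_of_mem hj)⟩

lemma crt_range (n : ℕ) (m a : ℕ → ℕ) (h0 : ∀ i < n, m i ≠ 0)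
    (hc : ∀ i < n, ∀ j < n, i ≠ j → Nat.Coprime (m i) (m j)) :
    ∃ x : ℕ, ∀ i < n, (x : ℤ) ≡ a i [ZMOD m i] := by
  let x := Nat.chineseRemainderOfFinset a m (Finset.range n)
    (fun i hi => h0 i (Finset.mem_range.1 hi))
    (fun i hi j hj hij => hc i (by simpa using hi) j (by simpa using hj) hij)
  refine ⟨x.1, fun i hi => ?_⟩
  rw [Int.natCast_modEq_iff]
  exact x.2 i (Finset.mem_range.2 hi)

lemma bforall_core (p : Poly (Option α ⊕ β)) :
    ∃ (l : List (Option α ⊕ β)) (c d : ℕ), ∀ (v : α → ℕ) (n : ℕ),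
      (∀ i < n, ∃ t : β → ℕ, p (Sum.elim (Option.elim' i v) t) = 0) ↔
      ∃ (T : β → ℕ) (I w W : ℕ), W = c * (w + 1) ^ d + w + 1 ∧ n ≤ w ∧
        (∀ j ∈ l, Sum.elim (Option.elim' 0 v) (fun _ => 0) j ≤ w) ∧
        (W ! * W ! + n).choose n ∣ W ! * W ! + I + 1 ∧
        (∀ j ∈ l, (W ! * W ! + n).choose n ∣
          (Sum.elim (fun _ => 0) T j).choose (w + 1)) ∧
        (W ! * W ! + n).choose n ∣ (p (Sum.elim (Option.elim' I v) T)).natAbs := by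
  obtain ⟨l, c, d, hmod, hbd⟩ := poly_data p
  refine ⟨l, c, d, fun v n => ⟨fun h => ?_, ?_⟩⟩
  · choose! t ht using h
    obtain ⟨w1, hw1⟩ := exists_list_bound l (Sum.elim (Option.elim' 0 v) (fun _ => 0))
    have : ∀ i, ∃ w, ∀ j ∈ l, Sum.elim (fun _ => 0) (t i) j ≤ w :=
      fun i => exists_list_bound l _
    choose w2 hw2 using this
    obtain ⟨w3, hw3⟩ := exists_list_bound (List.range n) w2
    set w := n + w1 + w3 with hw
    set W := c * (w + 1) ^ d + w + 1 with hW
    have hwW : w < W := by omega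
    set m : ℕ → ℕ := fun j => 1 + W ! * (W ! / (j + 1)) with hm
    have hc : ∀ i < n, ∀ j < n, i ≠ j → Nat.Coprime (m i) (m j) := fun i hi j hj hij =>
      factor_coprime W i j (by omega) (by omega) hij
    obtain ⟨I, hI⟩ := crt_range n m id (fun i hi => by simp [hm]) hc
    have hT : ∀ b : β, ∃ x : ℕ, ∀ i < n, (x : ℤ) ≡ t i b [ZMOD m i] := fun b =>
      crt_range n m (fun i => t i b) (fun i hi => by simp [hm]) hc
    choose T hT using hT
    have hM : ∀ z : ℕ, (∀ i < n, m i ∣ z) → (W ! * W ! + n).choose n ∣ z := by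
      intro z hz
      rw [choose_prod W n (by omega)]
      apply Finset.prod_dvd_of_isRelPrime
      · intro i hi j hj hij
        exact Nat.coprime_iff_isRelPrime.1 (hc i (by simpa using hi) j (by simpa using hj) hij)
      · intro i hi
        exact hz i (Finset.mem_range.1 hi)
    refine ⟨T, I, w, W, rfl, by omega, fun j hj => (hw1 j hj).trans (by omega), ?_, ?_, ?_⟩
    · apply hM
      intro i hi
      have h1 := factor_dvd W i (by omega)
      have h2 := hI i hi
      have h3 : ((W ! * W ! + I + 1 : ℕ) : ℤ) ≡ (W ! * W ! + i + 1 : ℕ) [ZMOD m i] := by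
        push_cast
        exact (h2.add_left _).add_right _
      have := (Nat.modEq_iff_dvd' (Nat.zero_le _)).2 (by simpa using h1)
      have h4 := (Int.natCast_modEq_iff.1 h3).trans this.symm
      exact (Nat.modEq_zero_iff_dvd).1 h4
    · intro j hj
      apply hM
      intro i hi
      rcases j with a | b
      · simp
      · simp only [Sum.elim_inr]
        refine small_residue' W i (T b) w (t i b) hwW ?_ (hT b i hi)
        have h1 := hw2 i _ hj
        have h2 := hw3 i (List.mem_range.2 hi)
        simp at h1
        omega
    · apply hM
      intro i hi
      have : p (Sum.elim (Option.elim' I v) T) ≡ p (Sum.elim (Option.elim' i v) (t i)) [ZMOD m i] := by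
        apply hmod
        intro j _
        rcases j with (_ | a) | b
        · exact hI i hi
        · exact Int.ModEq.refl _
        · exact hT b i hi
      rw [ht i hi] at this
      exact Int.natCast_dvd.1 (Int.modEq_zero_iff_dvd.1 this)
  · rintro ⟨T, I, w, W, hW, hn, hv, h1, h2, h3⟩ i hi
    have hwW : w < W := by omega
    obtain ⟨f, hf, hfd⟩ := Nat.exists_prime_and_dvd (factor_two W i (by omega))
    have hWf := factor_prime W i f hf hfd
    have hfM : f ∣ (W ! * W ! + n).choose n := by
      rw [choose_prod W n (by omega)]
      exact hfd.trans (Finset.dvd_prod_of_mem (fun j => 1 + W ! * (W ! / (j + 1)))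
        (Finset.mem_range.2 hi))
    have hI : (I : ℤ) ≡ i [ZMOD f] := by
      have e1 := hfM.trans h1
      have e2 := hfd.trans (factor_dvd W i (by omega))
      rw [Int.modEq_iff_dvd]
      have : (f : ℤ) ∣ ((W ! * W ! + i + 1 : ℕ) : ℤ) - (W ! * W ! + I + 1 : ℕ) :=
        dvd_sub (by exact_mod_cast e2) (by exact_mod_cast e1)
      push_cast at this
      convert this using 1
      ring
    have hr : ∀ b, ∃ r : ℕ, Sum.inr b ∈ l → (r ≤ w ∧ (T b : ℤ) ≡ r [ZMOD f]) := by
      intro b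
      by_cases hb : Sum.inr b ∈ l
      · obtain ⟨r, hr⟩ := small_residue f (T b) w hf (hfM.trans (h2 _ hb))
        exact ⟨r, fun _ => hr⟩
      · exact ⟨0, fun h => absurd h hb⟩
    choose r hr using hr
    refine ⟨r, ?_⟩
    have e : p (Sum.elim (Option.elim' I v) T) ≡ p (Sum.elim (Option.elim' i v) r) [ZMOD f] := by
      apply hmod
      intro j hj
      rcases j with (_ | a) | b
      · exact hI
      · exact Int.ModEq.refl _
      · exact (hr b hj).2
    have e0 : p (Sum.elim (Option.elim' I v) T) ≡ 0 [ZMOD f] :=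
      Int.modEq_zero_iff_dvd.2 (Int.natCast_dvd.2 (hfM.trans h3))
    have e2 := Int.natCast_dvd.1 (Int.modEq_zero_iff_dvd.1 (e.symm.trans e0))
    have hb := hbd w (Sum.elim (Option.elim' i v) r) (by
      intro j hj
      rcases j with (_ | a) | b
      · simp; omega
      · exact hv _ hj
      · exact (hr b hj).1)
    have := Nat.eq_zero_of_dvd_of_lt e2 (by omega)
    simpa using this

lemma dioph_bforall {P : (α → ℕ) → ℕ → Prop}
    (h : Dioph {w : Option α → ℕ | P (w ∘ some) (w none)}) {n : (α → ℕ) → ℕ} (dn : DiophFn n) :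
    Dioph {v | ∀ i < n v, P v i} := by
  obtain ⟨β, p, hp⟩ := h
  obtain ⟨l, c, d, key⟩ := bforall_core p
  have e : {v | ∀ i < n v, P v i} = {v | ∀ i < n v, ∃ t : β → ℕ,
      p (Sum.elim (Option.elim' i v) t) = 0} := by
    ext v
    refine forall_congr' fun i => forall_congr' fun _ => ?_
    exact hp (Option.elim' i v)
  rw [e]
  simp only [key]
  -- variables: (((α ⊕ β) + I) + w) + W
  have hX : Dioph {x : α ⊕ β → ℕ | ∃ I w W, W = c * (w + 1) ^ d + w + 1 ∧ n (x ∘ Sum.inl) ≤ w ∧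
        (∀ j ∈ l, Sum.elim (Option.elim' 0 (x ∘ Sum.inl)) (fun _ => 0) j ≤ w) ∧
        (W ! * W ! + n (x ∘ Sum.inl)).choose (n (x ∘ Sum.inl)) ∣ W ! * W ! + I + 1 ∧
        (∀ j ∈ l, (W ! * W ! + n (x ∘ Sum.inl)).choose (n (x ∘ Sum.inl)) ∣
          (Sum.elim (fun _ => 0) (x ∘ Sum.inr) j).choose (w + 1)) ∧
        (W ! * W ! + n (x ∘ Sum.inl)).choose (n (x ∘ Sum.inl)) ∣
          (p (Sum.elim (Option.elim' I (x ∘ Sum.inl)) (x ∘ Sum.inr))).natAbs} := by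
    apply dioph_dex
    apply dioph_dex
    apply dioph_dex
    have dn' : DiophFn (fun x : Option (Option (Option (α ⊕ β))) → ℕ =>
        n (((((x ∘ some) ∘ some) ∘ some)) ∘ Sum.inl)) :=
      reindex_diophFn (fun a => some (some (some (Sum.inl a)))) dn
    have dW : DiophFn (fun x : Option (Option (Option (α ⊕ β))) → ℕ => x none) := proj_dioph _
    have dw : DiophFn (fun x : Option (Option (Option (α ⊕ β))) → ℕ => (x ∘ some) none) :=
      proj_dioph _
    have dI : DiophFn (fun x : Option (Option (Option (α ⊕ β))) → ℕ => ((x ∘ some) ∘ some) none) :=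
      proj_dioph _
    have dq := mul_dioph (dioph_factorial dW) (dioph_factorial dW)
    have dM := dioph_choose (add_dioph dq dn') dn'
    refine inter (eq_dioph dW (add_dioph (add_dioph (mul_dioph (const_dioph c)
      (pow_dioph (add_dioph dw (const_dioph 1)) (const_dioph d))) dw) (const_dioph 1))) ?_
    refine inter (le_dioph dn' dw) ?_
    refine inter (dioph_list l ?_) ?_
    · rintro ((_ | a) | b)
      · exact le_dioph (const_dioph 0) dw
      · exact le_dioph (proj_dioph (some (some (some (Sum.inl a))))) dw
      · exact le_dioph (const_dioph 0) dw
    refine inter (dvd_dioph dM (add_dioph (add_dioph dq dI) (const_dioph 1))) ?_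
    refine inter (dioph_list l ?_) ?_
    · rintro (a | b)
      · exact dvd_dioph dM (dioph_choose (const_dioph 0) (add_dioph dw (const_dioph 1)))
      · exact dvd_dioph dM (dioph_choose (proj_dioph (some (some (some (Sum.inr b)))))
          (add_dioph dw (const_dioph 1)))
    · refine dvd_dioph dM ?_
      have := abs_poly_dioph (p.map (Sum.elim (fun o : Option α => (Option.elim' (some (some none))
        (fun a => some (some (some (Sum.inl a)))) o : Option (Option (Option (α ⊕ β)))))
        (fun b => some (some (some (Sum.inr b))))))
      convert this using 5 with x
      rw [Poly.map_apply]
      congr 1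
      funext s
      rcases s with (_ | a) | b <;> rfl
  exact Dioph.ext (ex_dioph hX) fun v => Iff.rfl
end

section
variable {α : Type}
open Dioph

lemma dioph_pair {f g : (α → ℕ) → ℕ} (df : DiophFn f) (dg : DiophFn g) :
    DiophFn fun v => Nat.pair (f v) (g v) := by
  have h0 : DiophFn (fun w : Option α → ℕ => w none) := proj_dioph _
  have df' := dioph_up df
  have dg' := dioph_up dg
  refine Dioph.ext (union (inter (lt_dioph df' dg') (eq_dioph h0 (add_dioph (mul_dioph dg' dg') df')))
    (inter (le_dioph dg' df') (eq_dioph h0 (add_dioph (add_dioph (mul_dioph df' df') df') dg')))) ?_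
  intro w
  simp only [Set.mem_union, Set.mem_inter_iff, Set.mem_ofPred_eq, Nat.pair]
  split_ifs <;> omega

lemma dioph_unpair_fst {f : (α → ℕ) → ℕ} (df : DiophFn f) : DiophFn fun v => (f v).unpair.1 := by
  have : Dioph {w : Option α → ℕ | ∃ y, Nat.pair (w none) y = f (w ∘ some)} := by
    apply dioph_dex
    exact eq_dioph (dioph_pair (proj_dioph (some none)) (proj_dioph none)) (dioph_up (dioph_up df))
  refine Dioph.ext this fun w => ⟨?_, ?_⟩
  · rintro ⟨y, hy⟩
    change (f (w ∘ some)).unpair.1 = w none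
    rw [← hy]; simp
  · intro h
    refine ⟨(f (w ∘ some)).unpair.2, ?_⟩
    change (f (w ∘ some)).unpair.1 = w none at h
    rw [← h]; simp

lemma dioph_unpair_snd {f : (α → ℕ) → ℕ} (df : DiophFn f) : DiophFn fun v => (f v).unpair.2 := by
  have : Dioph {w : Option α → ℕ | ∃ y, Nat.pair y (w none) = f (w ∘ some)} := by
    apply dioph_dex
    exact eq_dioph (dioph_pair (proj_dioph none) (proj_dioph (some none))) (dioph_up (dioph_up df))
  refine Dioph.ext this fun w => ⟨?_, ?_⟩
  · rintro ⟨y, hy⟩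
    change (f (w ∘ some)).unpair.2 = w none
    rw [← hy]; simp
  · intro h
    refine ⟨(f (w ∘ some)).unpair.1, ?_⟩
    change (f (w ∘ some)).unpair.2 = w none at h
    rw [← h]; simp

lemma dioph_beta {f g : (α → ℕ) → ℕ} (df : DiophFn f) (dg : DiophFn g) :
    DiophFn fun v => Nat.beta (f v) (g v) :=
  mod_dioph (dioph_unpair_fst df) (add_dioph (mul_dioph (add_dioph dg (const_dioph 1))
    (dioph_unpair_snd df)) (const_dioph 1))

lemma exists_beta (s : ℕ → ℕ) (n : ℕ) : ∃ c, ∀ i ≤ n, Nat.beta c i = s i := by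
  refine ⟨Nat.unbeta (List.ofFn fun i : Fin (n + 1) => s i), fun i hi => ?_⟩
  have := Nat.beta_unbeta_coe (List.ofFn fun i : Fin (n + 1) => s i) ⟨i, by simp; omega⟩
  simpa [-List.ofFn_succ] using this

lemma mem_prec (f g : ℕ →. ℕ) (a n m : ℕ) :
    m ∈ (n.rec (f a) fun y IH => IH.bind fun i => g (Nat.pair a (Nat.pair y i)) : Part ℕ) ↔
    ∃ s : ℕ → ℕ, s 0 ∈ f a ∧ (∀ y < n, s (y + 1) ∈ g (Nat.pair a (Nat.pair y (s y)))) ∧ s n = m := by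
  induction n generalizing m with
  | zero =>
    constructor
    · intro h; exact ⟨fun _ => m, h, by simp, rfl⟩
    · rintro ⟨s, h, _, rfl⟩; exact h
  | succ n ih =>
    simp only [Part.mem_bind_iff]
    constructor
    · rintro ⟨k, hk, hm⟩
      obtain ⟨s, h0, h1, rfl⟩ := (ih k).1 hk
      refine ⟨fun i => if i ≤ n then s i else m, by simpa using h0, fun y hy => ?_, by simp⟩
      rcases Nat.lt_or_ge y n with h | h
      · have := h1 y h
        simpa [show y + 1 ≤ n by omega, h.le] using this
      · obtain rfl : y = n := by omega
        simpa using hm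
    · rintro ⟨s, h0, h1, rfl⟩
      exact ⟨s n, (ih _).2 ⟨s, h0, fun y hy => h1 y (by omega), rfl⟩, h1 n (by omega)⟩

lemma partrec_dioph {f : ℕ →. ℕ} (hf : Nat.Partrec f) : ∀ (α : Type) (g h : (α → ℕ) → ℕ),
    DiophFn g → DiophFn h → Dioph {v | h v ∈ f (g v)} := by
  induction hf with
  | zero =>
    intro α g h dg dh
    refine Dioph.ext (eq_dioph dh (const_dioph 0)) fun v => ?_
    simp [pure, PFun.pure]
  | succ =>
    intro α g h dg dh
    refine Dioph.ext (eq_dioph dh (add_dioph dg (const_dioph 1))) fun v => ?_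
    simp
  | left =>
    intro α g h dg dh
    refine Dioph.ext (eq_dioph dh (dioph_unpair_fst dg)) fun v => ?_
    simp
  | right =>
    intro α g h dg dh
    refine Dioph.ext (eq_dioph dh (dioph_unpair_snd dg)) fun v => ?_
    simp
  | @pair f1 f2 _ _ ih1 ih2 =>
    intro α g h dg dh
    refine Dioph.ext (inter (ih1 α g _ dg (dioph_unpair_fst dh))
      (ih2 α g _ dg (dioph_unpair_snd dh))) fun v => ?_
    simp only [Set.mem_inter_iff, Set.mem_ofPred_eq, Seq.seq, Functor.map, Part.mem_bind_iff,
      Part.mem_map_iff]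
    constructor
    · rintro ⟨h1, h2⟩
      exact ⟨_, ⟨_, h1, rfl⟩, _, h2, by simp⟩
    · rintro ⟨_, ⟨a, h1, rfl⟩, b, h2, e⟩
      rw [← e]
      simpa using ⟨h1, h2⟩
  | @comp f1 f2 _ _ ih1 ih2 =>
    intro α g h dg dh
    have : Dioph {v | ∃ x, x ∈ f2 (g v) ∧ h v ∈ f1 x} := by
      apply dioph_dex
      exact inter (ih2 _ _ _ (dioph_up dg) (proj_dioph none))
        (ih1 _ _ _ (proj_dioph none) (dioph_up dh))
    refine Dioph.ext this fun v => ?_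
    exact Part.mem_bind_iff.symm
  | @prec f1 f2 _ _ ih1 ih2 =>
    intro α g h dg dh
    have : Dioph {v | ∃ c, Nat.beta c 0 ∈ f1 (g v).unpair.1 ∧
        (∀ y < (g v).unpair.2, Nat.beta c (y + 1) ∈
          f2 (Nat.pair (g v).unpair.1 (Nat.pair y (Nat.beta c y)))) ∧
        Nat.beta c (g v).unpair.2 = h v} := by
      apply dioph_dex
      have dc : DiophFn (fun w : Option α → ℕ => w none) := proj_dioph none
      have dg' := dioph_up dg
      refine inter (ih1 _ _ _ (dioph_unpair_fst dg') (dioph_beta dc (const_dioph 0))) ?_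
      refine inter (dioph_bforall ?_ (dioph_unpair_snd dg'))
        (eq_dioph (dioph_beta dc (dioph_unpair_snd dg')) (dioph_up dh))
      have dc' := dioph_up dc
      have dy : DiophFn (fun w : Option (Option α) → ℕ => w none) := proj_dioph none
      exact ih2 _ _ _ (dioph_pair (dioph_unpair_fst (dioph_up dg')) (dioph_pair dy (dioph_beta dc' dy)))
        (dioph_beta dc' (add_dioph dy (const_dioph 1)))
    refine Dioph.ext this fun v => ?_
    refine Iff.trans ?_ (mem_prec f1 f2 _ _ _).symm
    constructor
    · rintro ⟨c, h0, h1, h2⟩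
      exact ⟨Nat.beta c, h0, h1, h2⟩
    · rintro ⟨s, h0, h1, h2⟩
      obtain ⟨c, hc⟩ := exists_beta s (g v).unpair.2
      refine ⟨c, by rwa [hc 0 (by omega)], fun y hy => ?_, by rwa [hc _ le_rfl]⟩
      rw [hc _ hy, hc _ hy.le]
      exact h1 y hy
  | @rfind f1 _ ih =>
    intro α g h dg dh
    have : Dioph {v | 0 ∈ f1 (Nat.pair (g v) (h v)) ∧
        ∀ i < h v, ∃ m, m ≠ 0 ∧ m ∈ f1 (Nat.pair (g v) i)} := by
      refine inter (ih _ _ _ (dioph_pair dg dh) (const_dioph 0)) (dioph_bforall ?_ dh)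
      apply dioph_dex
      refine inter (ne_dioph (proj_dioph none) (const_dioph 0)) ?_
      exact ih _ _ _ (dioph_pair (dioph_up (dioph_up dg)) (proj_dioph (some none))) (proj_dioph none)
    refine Dioph.ext this fun v => ?_
    refine Iff.trans ?_ Nat.mem_rfind.symm
    constructor
    · rintro ⟨h0, h1⟩
      refine ⟨?_, fun {i} hi => ?_⟩
      · simpa using h0
      · obtain ⟨m, hm, hm'⟩ := h1 i hi
        simpa using ⟨m, hm', hm⟩
    · rintro ⟨h0, h1⟩
      refine ⟨?_, fun i hi => ?_⟩
      · simpa using h0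
      · have := h1 hi
        simp at this
        obtain ⟨m, hm, hm'⟩ := this
        exact ⟨m, hm', hm⟩
end
/-- The halting set is Diophantine. -/
lemma halting_dioph : ∃ (β : Type) (p : Poly (Unit ⊕ β)), ∀ n : ℕ,
    ((Denumerable.ofNat Nat.Partrec.Code n).eval 0).Dom ↔
      ∃ t : β → ℕ, p (Sum.elim (fun _ => n) t) = 0 := by
  have hp : Nat.Partrec fun n => (Denumerable.ofNat Nat.Partrec.Code n).eval 0 :=
    Partrec.nat_iff.1 (Nat.Partrec.Code.eval_part.comp (Computable.ofNat _) (Computable.const 0))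
  have : Dioph {v : Unit → ℕ | ∃ m, m ∈ (Denumerable.ofNat Nat.Partrec.Code (v ())).eval 0} := by
    apply dioph_dex
    exact partrec_dioph hp _ _ _ (dioph_up (Dioph.proj_dioph ())) (Dioph.proj_dioph none)
  obtain ⟨β, p, h⟩ := this
  refine ⟨β, p, fun n => ?_⟩
  rw [← h (fun _ => n)]
  exact Part.dom_iff_mem

end ArithmeticPart

/-- Terms for natural-number polynomials; `tri a` stands for `a * (a + 1)`. -/
inductive Tm : Type
  | var : ℕ → Tm
  | cst : ℕ → Tm
  | add : Tm → Tm → Tm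
  | mul : Tm → Tm → Tm
  | tri : Tm → Tm

namespace Tm

def eval (v : ℕ → ℕ) : Tm → ℕ
  | var i => v i
  | cst c => c
  | add a b => eval v a + eval v b
  | mul a b => eval v a * eval v b
  | tri a => eval v a * (eval v a + 1)

def code : Tm → ℕ
  | var i => Nat.pair 0 i
  | cst c => Nat.pair 1 c
  | add a b => Nat.pair 2 (Nat.pair (code a) (code b))
  | mul a b => Nat.pair 3 (Nat.pair (code a) (code b))
  | tri a => Nat.pair 4 (code a)

lemma code_inj : Function.Injective code := by
  intro a
  induction a with
  | var i => intro b h; cases b <;> simp_all [code, Nat.pair_eq_pair]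
  | cst i => intro b h; cases b <;> simp_all [code, Nat.pair_eq_pair]
  | add a b iha ihb =>
    intro c h
    cases c <;> simp [code, Nat.pair_eq_pair] at h
    rw [iha h.1, ihb h.2]
  | mul a b iha ihb =>
    intro c h
    cases c <;> simp [code, Nat.pair_eq_pair] at h
    rw [iha h.1, ihb h.2]
  | tri a iha =>
    intro c h
    cases c <;> simp [code, Nat.pair_eq_pair] at h
    rw [iha h]

end Tm

lemma poly_terms (q : Poly ℕ) : ∃ s t : Tm, ∀ x, q x = (s.eval x : ℤ) - t.eval x := by
  induction q using Poly.induction with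
  | H1 i => exact ⟨.var i, .cst 0, fun x => by simp [Tm.eval]⟩
  | H2 n =>
    refine ⟨.cst n.toNat, .cst (-n).toNat, fun x => ?_⟩
    simp only [Tm.eval, Poly.const_apply]; omega
  | H3 f g hf hg =>
    obtain ⟨s, t, h⟩ := hf
    obtain ⟨s', t', h'⟩ := hg
    refine ⟨.add s t', .add t s', fun x => ?_⟩
    rw [Poly.sub_apply, h, h']; simp only [Tm.eval]; push_cast; ring
  | H4 f g hf hg =>
    obtain ⟨s, t, h⟩ := hf
    obtain ⟨s', t', h'⟩ := hg
    refine ⟨.add (.mul s s') (.mul t t'), .add (.mul s t') (.mul t s'), fun x => ?_⟩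
    rw [Poly.mul_apply, h, h']; simp only [Tm.eval]; push_cast; ring

/-- Constraints on the universally quantified variables. -/
inductive Con : Type
  | eq : List ℕ × ℕ → List ℕ × ℕ → Con
  | tri : ℕ → ℕ → ℕ → Con

def lv (X : ℕ → ℕ) (P : List ℕ × ℕ) : ℕ := P.2 + (P.1.map X).sum

namespace Con

def Holds (X : ℕ → ℕ) : Con → Prop
  | eq P Q => lv X P = lv X Q
  | tri a b z => X b = X a + 1 ∧ X z = X a * (X a + 1)

def Bdd (N : ℕ) : Con → Prop
  | eq P Q => (∀ i ∈ P.1, i < N) ∧ ∀ i ∈ Q.1, i < N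
  | tri a b z => a < N ∧ b < N ∧ z < N

lemma exists_bdd (c : Con) : ∃ N, ∀ M ≥ N, c.Bdd M := by
  cases c with
  | eq P Q =>
    obtain ⟨N, hN⟩ := exists_list_bound P.1 id
    obtain ⟨N', hN'⟩ := exists_list_bound Q.1 id
    refine ⟨N + N' + 1, fun M hM => ⟨fun i hi => ?_, fun i hi => ?_⟩⟩
    · have := hN i hi; simp at this; omega
    · have := hN' i hi; simp at this; omega
  | tri a b z => exact ⟨a + b + z + 1, fun M hM => ⟨by omega, by omega, by omega⟩⟩

end Con

def mkPoly (N : ℕ) (P : List ℕ × ℕ) : LinPoly := ((List.range (N + 1)).map fun i => P.1.count i, P.2)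

lemma evalPoly_mk (N : ℕ) (P : List ℕ × ℕ) (v : ℕ → ℕ) (h : ∀ i ∈ P.1, i ≤ N) :
    evalPoly (mkPoly N P) v = lv v P := by
  obtain ⟨l, c⟩ := P
  simp only [evalPoly, mkPoly, lv, List.length_map, List.length_range]
  congr 1
  have : ∀ i ∈ Finset.range (N + 1),
      ((List.range (N + 1)).map fun i => l.count i).getD i 0 * v i = l.count i * v i := by
    intro i hi
    have := Finset.mem_range.1 hi
    simp [List.getD, this]
  rw [Finset.sum_congr rfl this]
  clear this
  induction l with
  | nil => simp
  | cons a l ih =>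
    simp only [List.map_cons, List.sum_cons]
    rw [← ih (fun i hi => h i (by simp [hi]))]
    simp only [List.count_cons, add_mul, Finset.sum_add_distrib]
    rw [add_comm]
    congr 1
    have ha : a < N + 1 := Nat.lt_succ_of_le (h a (by simp))
    simp [ha]

/-- The errors witnessing the failure of a constraint. -/
def errs (N : ℕ) : Con → List Disjunct
  | .eq P Q => [([], [(mkPoly N P, 0, mkPoly N Q)]), ([], [(mkPoly N P, 3, mkPoly N Q)])]
  | .tri a b z =>
    [([], [(mkPoly N ([b], 0), 0, mkPoly N ([a], 1))]),
     ([], [(mkPoly N ([b], 0), 3, mkPoly N ([a], 1))]),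
     ([(a, 0)], [(mkPoly N ([N], 0), 0, mkPoly N ([z], 0)),
        (mkPoly N ([z], 0), 0, mkPoly N ([N, a], 0))]),
     ([(b, 0)], [(mkPoly N ([N], 0), 0, mkPoly N ([z], 0)),
        (mkPoly N ([z], 0), 0, mkPoly N ([N, b], 0))]),
     ([(a, 0), (b, 0)], [(mkPoly N ([], 0), 0, mkPoly N ([N], 0)),
        (mkPoly N ([N], 0), 0, mkPoly N ([z], 0))]),
     ([], [(mkPoly N ([], 0), 0, mkPoly N ([a], 0)), (mkPoly N ([z], 0), 2, mkPoly N ([], 0))]),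
     ([], [(mkPoly N ([a], 0), 2, mkPoly N ([], 0)), (mkPoly N ([], 0), 0, mkPoly N ([z], 0))])]

def Sat (N : ℕ) (X Y : ℕ → ℕ) (dj : Disjunct) : Prop :=
  (∀ jk ∈ dj.1, X jk.1 ∣ Y jk.2) ∧
    (∀ A ∈ dj.2, atomHolds A (fun i => if i < N then X i else Y (i - N)))

lemma not_dvd_witness (a z : ℕ) (ha : 0 < a) (h : ¬ a ∣ z) : ∃ y, a ∣ y ∧ y < z ∧ z < y + a := by
  refine ⟨a * (z / a), dvd_mul_right _ _, ?_, ?_⟩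
  · have := Nat.div_add_mod z a
    have : z % a ≠ 0 := fun e => h (Nat.dvd_of_mod_eq_zero e)
    omega
  · have := Nat.div_add_mod z a
    have := Nat.mod_lt z ha
    omega

lemma dvd_no_witness (a y z : ℕ) (h : a ∣ z) (hy : a ∣ y) (h1 : y < z) (h2 : z < y + a) : False := by
  have := Nat.le_of_dvd (by omega) (Nat.dvd_sub h hy)
  omega

lemma tri_errors (a b z : ℕ) : ¬ (b = a + 1 ∧ z = a * (a + 1)) ↔
    ∃ y, b < a + 1 ∨ b > a + 1 ∨ (a ∣ y ∧ y < z ∧ z < y + a) ∨ (b ∣ y ∧ y < z ∧ z < y + b) ∨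
      ((a ∣ y ∧ b ∣ y) ∧ 0 < y ∧ y < z) ∨ (0 < a ∧ z = 0) ∨ (a = 0 ∧ 0 < z) := by
  constructor
  · intro h
    by_contra hne
    push Not at hne
    have h0 := hne 0
    obtain rfl : b = a + 1 := by omega
    apply h
    refine ⟨rfl, ?_⟩
    rcases Nat.eq_zero_or_pos a with rfl | ha
    · have := h0.2.2.2.2.2.2 rfl
      omega
    · have hz : 0 < z := by
        have := h0.2.2.2.2.2.1 ha
        omega
      have d1 : a ∣ z := by
        by_contra hd
        obtain ⟨y, hy, h1, h2⟩ := not_dvd_witness a z ha hd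
        have := (hne y).2.2.1 hy h1
        omega
      have d2 : (a + 1) ∣ z := by
        by_contra hd
        obtain ⟨y, hy, h1, h2⟩ := not_dvd_witness (a + 1) z (by omega) hd
        have := (hne y).2.2.2.1 hy h1
        omega
      have hc : Nat.Coprime a (a + 1) := by simp
      have h1 := Nat.le_of_dvd hz (hc.mul_dvd_of_dvd_of_dvd d1 d2)
      have h2 := (hne (a * (a + 1))).2.2.2.2.1 ⟨dvd_mul_right _ _, dvd_mul_left _ _⟩ (by positivity)
      omega
  · rintro ⟨y, hy⟩ ⟨rfl, rfl⟩
    rcases hy with h | h | ⟨h, h1, h2⟩ | ⟨h, h1, h2⟩ | ⟨⟨h, h'⟩, h1, h2⟩ | ⟨h1, h2⟩ | ⟨h1, h2⟩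
    · omega
    · omega
    · exact dvd_no_witness _ _ _ (dvd_mul_right _ _) h h1 h2
    · exact dvd_no_witness _ _ _ (dvd_mul_left _ _) h h1 h2
    · have hc : Nat.Coprime a (a + 1) := by simp
      have := Nat.le_of_dvd h1 (hc.mul_dvd_of_dvd_of_dvd h h')
      omega
    · have : 0 < a * (a + 1) := by positivity
      omega
    · subst h1; simp at h2

lemma errs_spec (N : ℕ) (c : Con) (hc : c.Bdd N) (X : ℕ → ℕ) :
    (∃ Y, ∃ dj ∈ errs N c, Sat N X Y dj) ↔ ¬ c.Holds X := by
  cases c with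
  | eq P Q =>
    obtain ⟨hP, hQ⟩ := hc
    have e : ∀ (P : List ℕ × ℕ) (Y : ℕ → ℕ), (∀ i ∈ P.1, i < N) →
        evalPoly (mkPoly N P) (fun i => if i < N then X i else Y (i - N)) = lv X P := by
      intro P Y h
      rw [evalPoly_mk N P _ fun i hi => (h i hi).le]
      unfold lv
      congr 2
      apply List.map_congr_left
      intro i hi
      simp [h i hi]
    simp only [errs, List.mem_cons, List.not_mem_nil, or_false, exists_eq_or_imp, exists_eq_left,
      Sat, false_imp_iff, implies_true, true_and, forall_eq, atomHolds, cmpHolds, e P _ hP, e Q _ hQ,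
      Con.Holds, exists_const]
    omega
  | tri a b z =>
    obtain ⟨ha, hb, hz⟩ := hc
    rw [Con.Holds, tri_errors]
    have e : ∀ (P : List ℕ × ℕ) (v : ℕ → ℕ), (∀ i ∈ P.1, i ≤ N) →
        evalPoly (mkPoly N P) v = lv v P := fun P v h => evalPoly_mk N P v h
    have key : ∀ Y : ℕ → ℕ, (∃ dj ∈ errs N (.tri a b z), Sat N X Y dj) ↔
        (X b < X a + 1 ∨ X b > X a + 1 ∨ (X a ∣ Y 0 ∧ Y 0 < X z ∧ X z < Y 0 + X a) ∨
          (X b ∣ Y 0 ∧ Y 0 < X z ∧ X z < Y 0 + X b) ∨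
          ((X a ∣ Y 0 ∧ X b ∣ Y 0) ∧ 0 < Y 0 ∧ Y 0 < X z) ∨
          (0 < X a ∧ X z = 0) ∨ (X a = 0 ∧ 0 < X z)) := by
      intro Y
      have e1 : ∀ v, evalPoly (mkPoly N ([a], 0)) v = v a := fun v => by
        rw [e _ _ (by simp; omega)]; simp [lv]
      have e2 : ∀ v, evalPoly (mkPoly N ([b], 0)) v = v b := fun v => by
        rw [e _ _ (by simp; omega)]; simp [lv]
      have e3 : ∀ v, evalPoly (mkPoly N ([z], 0)) v = v z := fun v => by
        rw [e _ _ (by simp; omega)]; simp [lv]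
      have e4 : ∀ v, evalPoly (mkPoly N ([N], 0)) v = v N := fun v => by
        rw [e _ _ (by simp)]; simp [lv]
      have e5 : ∀ v, evalPoly (mkPoly N ([], 0)) v = 0 := fun v => by
        rw [e _ _ (by simp)]; simp [lv]
      have e6 : ∀ v, evalPoly (mkPoly N ([a], 1)) v = v a + 1 := fun v => by
        rw [e _ _ (by simp; omega)]; simp [lv, add_comm]
      have e7 : ∀ v, evalPoly (mkPoly N ([N, a], 0)) v = v N + v a := fun v => by
        rw [e _ _ (by simp; omega)]; simp [lv]
      have e8 : ∀ v, evalPoly (mkPoly N ([N, b], 0)) v = v N + v b := fun v => by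
        rw [e _ _ (by simp; omega)]; simp [lv]
      simp only [errs, List.mem_cons, List.not_mem_nil, or_false, exists_eq_or_imp, exists_eq_left,
        Sat, false_imp_iff, implies_true, true_and, forall_eq, forall_eq_or_imp, atomHolds, cmpHolds,
        e1, e2, e3, e4, e5, e6, e7, e8, ha, hb, hz, if_true, lt_irrefl, if_false, Nat.sub_self]
    simp only [key]
    constructor
    · rintro ⟨Y, h⟩; exact ⟨Y 0, h⟩
    · rintro ⟨y, h⟩; exact ⟨fun _ => y, h⟩

/-- The constraint `x_{tri t} = x_t (x_t + 1)`. -/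
def trin (t : Tm) : Con := .tri t.code (Tm.add t (.cst 1)).code (Tm.tri t).code

/-- The constraints forcing `x_{code t}` to be the value of `t`. -/
def cons : Tm → List Con
  | .var _ => []
  | .cst c => [.eq ([(Tm.cst c).code], 0) ([], c)]
  | .add a b => .eq ([(Tm.add a b).code], 0) ([a.code, b.code], 0) :: (cons a ++ cons b)
  | .mul a b =>
    .eq ([(Tm.add a b).code], 0) ([a.code, b.code], 0) ::
    .eq ([(Tm.tri (.add a b)).code], 0)
      ([(Tm.tri a).code, (Tm.tri b).code, (Tm.mul a b).code, (Tm.mul a b).code], 0) ::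
    trin a :: trin b :: trin (.add a b) :: (cons a ++ cons b)
  | .tri a => trin a :: cons a

lemma cons_sound (X : ℕ → ℕ) (t : Tm) (h : ∀ c ∈ cons t, c.Holds X) :
    X t.code = t.eval (fun i => X (Tm.var i).code) := by
  induction t with
  | var i => rfl
  | cst c => simpa [cons, Con.Holds, lv, Tm.eval] using h
  | add a b iha ihb =>
    have h1 := iha fun c hc => h c (by simp [cons, hc])
    have h2 := ihb fun c hc => h c (by simp [cons, hc])
    have := h _ (List.mem_cons_self)
    simp only [Con.Holds, lv] at this
    simp at this
    rw [this, h1, h2, Tm.eval]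
  | mul a b iha ihb =>
    have h1 := iha fun c hc => h c (by simp [cons, hc])
    have h2 := ihb fun c hc => h c (by simp [cons, hc])
    have e1 := h (.eq ([(Tm.add a b).code], 0) ([a.code, b.code], 0)) (by simp [cons])
    have e2 := h (.eq ([(Tm.tri (.add a b)).code], 0)
      ([(Tm.tri a).code, (Tm.tri b).code, (Tm.mul a b).code, (Tm.mul a b).code], 0))
      (by simp [cons])
    have e3 := (h (trin a) (by simp [cons])).2
    have e4 := (h (trin b) (by simp [cons])).2
    have e5 := (h (trin (.add a b)) (by simp [cons])).2
    simp [Con.Holds, lv] at e1 e2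
    rw [Tm.eval, ← h1, ← h2]
    rw [e3, e4, e5, e1] at e2
    nlinarith
  | tri a iha =>
    have h1 := iha fun c hc => h c (by simp [cons, hc])
    have e3 := (h (trin a) (by simp [cons])).2
    rw [e3, h1, Tm.eval]

lemma cons_complete (X v : ℕ → ℕ) (hX : ∀ t : Tm, X t.code = t.eval v) (t : Tm) :
    ∀ c ∈ cons t, c.Holds X := by
  have ht : ∀ t, (trin t).Holds X := by
    intro t
    simp [trin, Con.Holds, hX, Tm.eval]
  induction t with
  | var i => simp [cons]
  | cst c => simp [cons, Con.Holds, lv, hX, Tm.eval]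
  | add a b iha ihb =>
    intro c hc
    simp only [cons, List.mem_cons, List.mem_append] at hc
    rcases hc with rfl | hc | hc
    · simp [Con.Holds, lv, hX, Tm.eval]
    · exact iha c hc
    · exact ihb c hc
  | mul a b iha ihb =>
    intro c hc
    simp only [cons, List.mem_cons, List.mem_append] at hc
    rcases hc with rfl | rfl | rfl | rfl | rfl | hc | hc
    · simp [Con.Holds, lv, hX, Tm.eval]
    · simp [Con.Holds, lv, hX, Tm.eval]; ring
    · exact ht _
    · exact ht _
    · exact ht _
    · exact iha c hc
    · exact ihb c hc
  | tri a iha =>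
    intro c hc
    simp only [cons, List.mem_cons] at hc
    rcases hc with rfl | hc
    · exact ht _
    · exact iha c hc

/-- The halting set as the zero set of a polynomial in variables indexed by `ℕ`. -/
lemma halting_poly : ∃ q : Poly ℕ, ∀ n : ℕ,
    ((Denumerable.ofNat Nat.Partrec.Code n).eval 0).Dom ↔ ∃ x : ℕ → ℕ, x 0 = n ∧ q x = 0 := by
  classical
  obtain ⟨β, p, hp⟩ := halting_dioph
  obtain ⟨l, _, _, hl, _⟩ := poly_data p
  have hpos : ∀ b : β, ∃ k : ℕ, (Sum.inr b : Unit ⊕ β) ∈ l → l[k]? = some (Sum.inr b) := by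
    intro b
    by_cases hb : (Sum.inr b : Unit ⊕ β) ∈ l
    · obtain ⟨k, hk⟩ := List.mem_iff_getElem?.1 hb
      exact ⟨k, fun _ => hk⟩
    · exact ⟨0, fun h => absurd h hb⟩
  choose pos hpos using hpos
  let e : Unit ⊕ β → ℕ := Sum.elim (fun _ => 0) (fun b => 1 + pos b)
  refine ⟨p.map e, fun n => (hp n).trans ⟨?_, ?_⟩⟩
  · rintro ⟨t, ht⟩
    refine ⟨fun k => if k = 0 then n else
      Sum.elim (fun _ => n) t (l.getD (k - 1) (Sum.inl ())), by simp, ?_⟩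
    rw [Poly.map_apply, ← ht]
    have := hl 0 ((fun k => if k = 0 then n else
      Sum.elim (fun _ => n) t (l.getD (k - 1) (Sum.inl ()))) ∘ e) (Sum.elim (fun _ => n) t) ?_
    · simpa [Int.ModEq] using this
    · rintro (a | b) hj
      · simp [e]
      · simp [e, List.getD, hpos b hj]
  · rintro ⟨x, hx, h⟩
    refine ⟨fun b => x (e (Sum.inr b)), ?_⟩
    rw [Poly.map_apply] at h
    rw [← h]
    congr 1
    funext s
    rcases s with a | b
    · simp [e, hx]
    · rfl

lemma halting_cons : ∃ L : List Con, ∀ n : ℕ,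
    ((Denumerable.ofNat Nat.Partrec.Code n).eval 0).Dom ↔
      ∃ X : ℕ → ℕ, ∀ c ∈ Con.eq ([0], 0) ([], n) :: L, c.Holds X := by
  obtain ⟨q, hq⟩ := halting_poly
  obtain ⟨s, t, hst⟩ := poly_terms q
  refine ⟨.eq ([s.code], 0) ([t.code], 0) :: (cons s ++ cons t), fun n => (hq n).trans ⟨?_, ?_⟩⟩
  · rintro ⟨x, hx, h⟩
    rw [hst] at h
    have : Nonempty Tm := ⟨.cst 0⟩
    have hX : ∀ τ : Tm, (fun k => (Function.invFun Tm.code k).eval x) τ.code = τ.eval x := by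
      intro τ
      simp only [Function.leftInverse_invFun Tm.code_inj τ]
    refine ⟨fun k => (Function.invFun Tm.code k).eval x, fun c hc => ?_⟩
    generalize (fun k => (Function.invFun Tm.code k).eval x) = X at hX
    simp only [List.mem_cons, List.mem_append] at hc
    rcases hc with rfl | rfl | hc | hc
    · have h0 := hX (.var 0)
      simp [Tm.code, Tm.eval, Nat.pair] at h0
      simp [Con.Holds, lv, h0, hx]
    · simp [Con.Holds, lv, hX]; omega
    · exact cons_complete X x hX s c hc
    · exact cons_complete X x hX t c hc
  · rintro ⟨X, hX⟩
    refine ⟨fun i => X (Tm.var i).code, ?_, ?_⟩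
    · have := hX _ (List.mem_cons_self)
      simpa [Con.Holds, lv, Tm.code, Nat.pair] using this
    · have h1 := cons_sound X s fun c hc => hX c (by simp [hc])
      have h2 := cons_sound X t fun c hc => hX c (by simp [hc])
      have h3 := hX (.eq ([s.code], 0) ([t.code], 0)) (by simp)
      simp [Con.Holds, lv] at h3
      rw [hst, ← h1, ← h2, h3]; simp

/-- **Undecidability of the `∀∃_R PAD⁺` fragment of Presburger arithmetic with
divisibility over `ℕ`**: there is no algorithm that, given a sentence
`∀x₁,…,xₙ ∃y₁,…,y_m ⋁_{i∈I} (⋀_{(j,k)∈Sᵢ} x_j | y_k ∧ ⋀_{l∈Bᵢ} A_l(x,y))`,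
decides whether it holds over `ℕ`. -/
theorem pad_fragment_undecidable : ¬ ComputablePred SentenceHolds := by
  intro hdec
  obtain ⟨L, hL⟩ := halting_cons
  have hN : ∃ N, 0 < N ∧ ∀ c ∈ L, c.Bdd N := by
    choose f hf using Con.exists_bdd
    obtain ⟨N, hN⟩ := exists_list_bound L f
    exact ⟨N + 1, by omega, fun c hc => hf c _ ((hN c hc).trans (by omega))⟩
  obtain ⟨N, hN0, hN⟩ := hN
  let S : ℕ → Sentence := fun n =>
    (N, 1, errs N (Con.eq ([0], 0) ([], n)) ++ L.flatMap (errs N))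
  have hS : ∀ n, SentenceHolds (S n) ↔ ¬ ((Denumerable.ofNat Nat.Partrec.Code n).eval 0).Dom := by
    intro n
    rw [hL]
    push Not
    refine forall_congr' fun X => ?_
    have hB : ∀ c ∈ Con.eq ([0], 0) ([], n) :: L, c.Bdd N := by
      intro c hc
      rcases List.mem_cons.1 hc with rfl | hc
      · simpa [Con.Bdd] using hN0
      · exact hN c hc
    constructor
    · rintro ⟨Y, dj, hdj, h⟩
      have hdj' : dj ∈ (Con.eq ([0], 0) ([], n) :: L).flatMap (errs N) := by
        simpa [S] using hdj
      obtain ⟨c, hc, hd⟩ := List.mem_flatMap.1 hdj'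
      exact ⟨c, hc, (errs_spec N c (hB c hc) X).1 ⟨Y, dj, hd, h⟩⟩
    · rintro ⟨c, hc, hn⟩
      obtain ⟨Y, dj, hd, h⟩ := (errs_spec N c (hB c hc) X).2 hn
      have hdj' : dj ∈ (Con.eq ([0], 0) ([], n) :: L).flatMap (errs N) :=
        List.mem_flatMap.2 ⟨c, hc, hd⟩
      exact ⟨Y, dj, by simpa [S] using hdj', h⟩
  have hSc : Computable S := by
    have hq : Primrec fun n : ℕ => (mkPoly N ([], n) : LinPoly) := by
      have : (fun n : ℕ => (mkPoly N ([], n) : LinPoly)) = fun n : ℕ => ((mkPoly N ([], 0)).1, n) := rfl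
      rw [this]
      exact Primrec.pair (Primrec.const _) Primrec.id
    have hd : ∀ k : ℕ, Primrec fun n : ℕ =>
        (([], [(mkPoly N ([0], 0), k, mkPoly N ([], n))]) : Disjunct) := fun k =>
      Primrec.pair (Primrec.const _) (Primrec.list_cons.comp
        (Primrec.pair (Primrec.const _) (Primrec.pair (Primrec.const _) hq)) (Primrec.const _))
    have : Primrec S := Primrec.pair (Primrec.const _) (Primrec.pair (Primrec.const _)
      (Primrec.list_cons.comp (hd 0) (Primrec.list_cons.comp (hd 3) (Primrec.const _))))
    exact this.to_comp
  refine ComputablePred.halting_problem 0 ?_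
  have h1 : ComputablePred fun c : Nat.Partrec.Code => ¬ SentenceHolds (S (Encodable.encode c)) :=
    ComputablePred.not (ComputablePred.computable_of_manyOneReducible
      ⟨fun c : Nat.Partrec.Code => S (Encodable.encode c), hSc.comp Computable.encode,
        fun _ => Iff.rfl⟩ hdec)
  refine h1.of_eq fun c => ?_
  rw [hS]
  simp

end PAD
end
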